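/- Let u, v be smooth functions on an open neighborhood D of the origin in ℝ² with |∇u| < 1 and |∇v| < 1 on D, both satisfying div(∇w/√(1−|∇w|²)) = 2H on D for the same constant H. Suppose u and v have a second-order contact at the origin (i.e., u − v and all its partial derivatives up to order 2 vanish at (0,0)) and u − v is not identically zero near the origin. Then there exist an invertible linear change of coordinates (x,y) ↦ (ξ,η) fixing the origin, an integer n ≥ 3, and a nonzero complex number λ such that, in the new coordinates, u − v = Re(λ·(ξ + iη)ⁿ) + o((ξ² + η²)^{n/2}) as (ξ,η) → (0,0). -/

import Mathlib

open Real Set Asymptotics Filter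

/-- First partial derivative (in the x-direction) of `f : ℝ × ℝ → ℝ`. -/
noncomputable def pd1 (f : ℝ × ℝ → ℝ) (x : ℝ × ℝ) : ℝ := fderiv ℝ f x (1, 0)

/-- Second partial derivative (in the y-direction) of `f : ℝ × ℝ → ℝ`. -/
noncomputable def pd2 (f : ℝ × ℝ → ℝ) (x : ℝ × ℝ) : ℝ := fderiv ℝ f x (0, 1)

/-- Squared norm of the Euclidean gradient `|∇f|²`. -/
noncomputable def gradSq (f : ℝ × ℝ → ℝ) (x : ℝ × ℝ) : ℝ := (pd1 f x)^2 + (pd2 f x)^2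

/-- The spacelike mean curvature operator `div (∇u / √(1 - |∇u|²))`. -/
noncomputable def cmcDiv (f : ℝ × ℝ → ℝ) (x : ℝ × ℝ) : ℝ :=
  pd1 (fun y => pd1 f y / Real.sqrt (1 - gradSq f y)) x +
  pd2 (fun y => pd2 f y / Real.sqrt (1 - gradSq f y)) x

section PartialDerivatives

variable {f g : ℝ × ℝ → ℝ} {D : Set (ℝ × ℝ)} {x : ℝ × ℝ}

lemma ContDiffOn.differentiableAt_of_isOpen (hf : ContDiffOn ℝ (⊤ : ℕ∞) f D) (hD : IsOpen D)
    (hx : x ∈ D) : DifferentiableAt ℝ f x :=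
  (hf.contDiffAt (hD.mem_nhds hx)).differentiableAt (by simp)

lemma ContDiffOn.pd1 (hf : ContDiffOn ℝ (⊤ : ℕ∞) f D) (hD : IsOpen D) :
    ContDiffOn ℝ (⊤ : ℕ∞) (pd1 f) D :=
  (hf.fderiv_of_isOpen hD (m := (⊤ : ℕ∞)) (by simp)).clm_apply contDiffOn_const

lemma ContDiffOn.pd2 (hf : ContDiffOn ℝ (⊤ : ℕ∞) f D) (hD : IsOpen D) :
    ContDiffOn ℝ (⊤ : ℕ∞) (pd2 f) D :=
  (hf.fderiv_of_isOpen hD (m := (⊤ : ℕ∞)) (by simp)).clm_apply contDiffOn_const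

lemma pd1_congr (h : f =ᶠ[nhds x] g) : pd1 f x = pd1 g x := by
  simp only [pd1, h.fderiv_eq]

lemma pd2_congr (h : f =ᶠ[nhds x] g) : pd2 f x = pd2 g x := by
  simp only [pd2, h.fderiv_eq]

lemma Filter.EventuallyEq.pd1 (h : f =ᶠ[nhds x] g) : pd1 f =ᶠ[nhds x] pd1 g :=
  (h.fderiv (𝕜 := ℝ)).mono fun y hy => by simp only [_root_.pd1, hy]

lemma Filter.EventuallyEq.pd2 (h : f =ᶠ[nhds x] g) : pd2 f =ᶠ[nhds x] pd2 g :=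
  (h.fderiv (𝕜 := ℝ)).mono fun y hy => by simp only [_root_.pd2, hy]

lemma pd1_add (hf : DifferentiableAt ℝ f x) (hg : DifferentiableAt ℝ g x) :
    pd1 (fun y => f y + g y) x = pd1 f x + pd1 g x := by
  simp only [pd1, fderiv_fun_add hf hg, add_apply]

lemma pd2_add (hf : DifferentiableAt ℝ f x) (hg : DifferentiableAt ℝ g x) :
    pd2 (fun y => f y + g y) x = pd2 f x + pd2 g x := by
  simp only [pd2, fderiv_fun_add hf hg, add_apply]

lemma pd1_sub (hf : DifferentiableAt ℝ f x) (hg : DifferentiableAt ℝ g x) :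
    pd1 (fun y => f y - g y) x = pd1 f x - pd1 g x := by
  simp only [pd1, fderiv_fun_sub hf hg, sub_apply]

lemma pd2_sub (hf : DifferentiableAt ℝ f x) (hg : DifferentiableAt ℝ g x) :
    pd2 (fun y => f y - g y) x = pd2 f x - pd2 g x := by
  simp only [pd2, fderiv_fun_sub hf hg, sub_apply]

lemma pd1_mul (hf : DifferentiableAt ℝ f x) (hg : DifferentiableAt ℝ g x) :
    pd1 (fun y => f y * g y) x = pd1 f x * g x + f x * pd1 g x := by
  simp only [pd1, fderiv_fun_mul hf hg, add_apply,
    smul_apply, smul_eq_mul]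
  ring

lemma pd2_mul (hf : DifferentiableAt ℝ f x) (hg : DifferentiableAt ℝ g x) :
    pd2 (fun y => f y * g y) x = pd2 f x * g x + f x * pd2 g x := by
  simp only [pd2, fderiv_fun_mul hf hg, add_apply,
    smul_apply, smul_eq_mul]
  ring

lemma pd1_const (c : ℝ) : pd1 (fun _ => c) x = 0 := by simp [pd1]

lemma pd2_const (c : ℝ) : pd2 (fun _ => c) x = 0 := by simp [pd2]

lemma pd1_pd2_comm (hf : ContDiffOn ℝ (⊤ : ℕ∞) f D) (hD : IsOpen D) (hx : x ∈ D) :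
    pd1 (pd2 f) x = pd2 (pd1 f) x := by
  have hfx := hf.contDiffAt (hD.mem_nhds hx)
  have hd : DifferentiableAt ℝ (fderiv ℝ f) x :=
    ((hf.fderiv_of_isOpen hD (m := (⊤ : ℕ∞)) (by simp)).contDiffAt
      (hD.mem_nhds hx)).differentiableAt (by simp)
  have hs : IsSymmSndFDerivAt ℝ f x := hfx.isSymmSndFDerivAt (by
    rw [minSmoothness_of_isRCLikeNormedField]
    exact WithTop.coe_le_coe.2 (le_top (a := (2 : ℕ∞))))
  have key (a b : ℝ × ℝ) :
      fderiv ℝ (fun y => fderiv ℝ f y a) x b = fderiv ℝ (fderiv ℝ f) x b a := by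
    rw [fderiv_clm_apply hd (by fun_prop)]
    simp
  change fderiv ℝ (fun y => fderiv ℝ f y (0, 1)) x (1, 0)
    = fderiv ℝ (fun y => fderiv ℝ f y (1, 0)) x (0, 1)
  rw [key, key, hs.eq]

lemma fderiv_apply_eq_pd (f : ℝ × ℝ → ℝ) (x v : ℝ × ℝ) :
    fderiv ℝ f x v = v.1 * pd1 f x + v.2 * pd2 f x := by
  have hv : v = v.1 • ((1, 0) : ℝ × ℝ) + v.2 • ((0, 1) : ℝ × ℝ) := by ext <;> simp
  conv_lhs => rw [hv, map_add, map_smul, map_smul]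
  simp only [pd1, pd2, smul_eq_mul]

lemma norm_fderiv_le_pd (f : ℝ × ℝ → ℝ) (x : ℝ × ℝ) :
    ‖fderiv ℝ f x‖ ≤ |pd1 f x| + |pd2 f x| := by
  refine ContinuousLinearMap.opNorm_le_bound _ (by positivity) fun v => ?_
  rw [fderiv_apply_eq_pd, Real.norm_eq_abs]
  have h1 : |v.1| ≤ ‖v‖ := norm_fst_le v
  have h2 : |v.2| ≤ ‖v‖ := norm_snd_le v
  calc |v.1 * pd1 f x + v.2 * pd2 f x| ≤ |v.1| * |pd1 f x| + |v.2| * |pd2 f x| := by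
        simpa only [abs_mul] using abs_add_le (v.1 * pd1 f x) (v.2 * pd2 f x)
    _ ≤ ‖v‖ * |pd1 f x| + ‖v‖ * |pd2 f x| := by gcongr
    _ = _ := by ring

/-- If both partial derivatives are `o(‖x‖ ^ n)` at the origin and the function vanishes there,
then the function is `o(‖x‖ ^ (n + 1))`. -/
lemma isLittleO_pow_succ_of_pd {n : ℕ} (hf : ∀ᶠ x in nhds 0, DifferentiableAt ℝ f x)
    (h0 : f 0 = 0) (h1 : pd1 f =o[nhds 0] fun x : ℝ × ℝ => ‖x‖ ^ n)
    (h2 : pd2 f =o[nhds 0] fun x : ℝ × ℝ => ‖x‖ ^ n) :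
    f =o[nhds 0] fun x : ℝ × ℝ => ‖x‖ ^ (n + 1) := by
  rw [isLittleO_iff] at *
  intro c hc
  have hc2 : 0 < c / 2 := by positivity
  obtain ⟨r, hr, hball⟩ := Metric.eventually_nhds_iff_ball.1 (hf.and ((h1 hc2).and (h2 hc2)))
  filter_upwards [Metric.ball_mem_nhds (0 : ℝ × ℝ) hr] with x hx
  have hsub : Metric.closedBall (0 : ℝ × ℝ) ‖x‖ ⊆ Metric.ball 0 r :=
    Metric.closedBall_subset_ball (by simpa using hx)
  have := (convex_closedBall (0 : ℝ × ℝ) ‖x‖).norm_image_sub_le_of_norm_fderiv_le (𝕜 := ℝ) (f := f)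
    (C := c * ‖x‖ ^ n) (fun y hy => (hball y (hsub hy)).1) (fun y hy => ?_)
    (x := 0) (y := x) (by simp) (by simp)
  · simp only [h0, sub_zero] at this
    simpa [pow_succ, mul_assoc] using this
  · obtain ⟨-, ha, hb⟩ := hball y (hsub hy)
    have hyx : ‖y‖ ≤ ‖x‖ := by simpa using hy
    have hp : ‖y‖ ^ n ≤ ‖x‖ ^ n := by gcongr
    rw [norm_pow, norm_norm, Real.norm_eq_abs] at ha hb
    calc _ ≤ _ := norm_fderiv_le_pd f y
      _ ≤ c / 2 * ‖y‖ ^ n + c / 2 * ‖y‖ ^ n := add_le_add ha hb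
      _ = c * ‖y‖ ^ n := by ring
      _ ≤ _ := by gcongr

end PartialDerivatives

section Flat

/-- `Flat k f` means that all partial derivatives of `f` of order less than `k` vanish at `0`. -/
def Flat : ℕ → (ℝ × ℝ → ℝ) → Prop
  | 0, _ => True
  | k + 1, f => f 0 = 0 ∧ Flat k (pd1 f) ∧ Flat k (pd2 f)

variable {f g : ℝ × ℝ → ℝ} {D : Set (ℝ × ℝ)} {j k : ℕ}

lemma Flat.congr (hf : Flat k f) (h : f =ᶠ[nhds 0] g) : Flat k g := by
  induction k generalizing f g with
  | zero => trivial
  | succ k ih => exact ⟨h.eq_of_nhds ▸ hf.1, ih hf.2.1 h.pd1, ih hf.2.2 h.pd2⟩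

lemma Flat.of_succ (hf : Flat (k + 1) f) : Flat k f := by
  induction k generalizing f with
  | zero => trivial
  | succ k ih => exact ⟨hf.1, ih hf.2.1, ih hf.2.2⟩

lemma Flat.mono (hf : Flat k f) (h : j ≤ k) : Flat j f := by
  induction h with
  | refl => exact hf
  | step _ ih => exact ih hf.of_succ

lemma Flat.add (hD : IsOpen D) (h0 : (0 : ℝ × ℝ) ∈ D) (sf : ContDiffOn ℝ (⊤ : ℕ∞) f D)
    (sg : ContDiffOn ℝ (⊤ : ℕ∞) g D) (hf : Flat k f) (hg : Flat k g) :
    Flat k (fun x => f x + g x) := by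
  induction k generalizing f g with
  | zero => trivial
  | succ k ih =>
    refine ⟨by simp [hf.1, hg.1], ?_, ?_⟩
    · refine (ih (sf.pd1 hD) (sg.pd1 hD) hf.2.1 hg.2.1).congr ?_
      filter_upwards [hD.mem_nhds h0] with x hx
      rw [pd1_add (sf.differentiableAt_of_isOpen hD hx) (sg.differentiableAt_of_isOpen hD hx)]
    · refine (ih (sf.pd2 hD) (sg.pd2 hD) hf.2.2 hg.2.2).congr ?_
      filter_upwards [hD.mem_nhds h0] with x hx
      rw [pd2_add (sf.differentiableAt_of_isOpen hD hx) (sg.differentiableAt_of_isOpen hD hx)]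

lemma Flat.mul (hD : IsOpen D) (h0 : (0 : ℝ × ℝ) ∈ D) (sf : ContDiffOn ℝ (⊤ : ℕ∞) f D)
    (sg : ContDiffOn ℝ (⊤ : ℕ∞) g D) (hf : Flat j f) (hg : Flat k g) :
    Flat (j + k) (fun x => f x * g x) := by
  obtain ⟨m, hm⟩ : ∃ m, m = j + k := ⟨_, rfl⟩
  rw [← hm]
  induction m generalizing f g j k with
  | zero => trivial
  | succ m ih =>
    have hz : f 0 * g 0 = 0 := by
      rcases j with _ | j
      · obtain rfl : k = m + 1 := by omega
        rw [hg.1, mul_zero]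
      · rw [hf.1, zero_mul]
    have left {f' : ℝ × ℝ → ℝ} (sf' : ContDiffOn ℝ (⊤ : ℕ∞) f' D)
        (hf' : ∀ i, j = i + 1 → Flat i f') : Flat m (fun x => f' x * g x) := by
      rcases j with _ | j
      · exact (ih (j := 0) sf' sg trivial (hg.mono (j := m) (by omega)) (by omega))
      · exact ih sf' sg (hf' j rfl) hg (by omega)
    have right {g' : ℝ × ℝ → ℝ} (sg' : ContDiffOn ℝ (⊤ : ℕ∞) g' D)
        (hg' : ∀ i, k = i + 1 → Flat i g') : Flat m (fun x => f x * g' x) := by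
      rcases k with _ | k
      · exact (ih (k := 0) sf sg' (hf.mono (j := m) (by omega)) trivial (by omega))
      · exact ih sf sg' hf (hg' k rfl) (by omega)
    refine ⟨hz, ?_, ?_⟩
    · have h1 := left (sf.pd1 hD) (fun i hi => by subst hi; exact hf.2.1)
      have h2 := right (sg.pd1 hD) (fun i hi => by subst hi; exact hg.2.1)
      refine (h1.add hD h0 ((sf.pd1 hD).mul sg) (sf.mul (sg.pd1 hD)) h2).congr ?_
      filter_upwards [hD.mem_nhds h0] with x hx
      rw [pd1_mul (sf.differentiableAt_of_isOpen hD hx) (sg.differentiableAt_of_isOpen hD hx)]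
    · have h1 := left (sf.pd2 hD) (fun i hi => by subst hi; exact hf.2.2)
      have h2 := right (sg.pd2 hD) (fun i hi => by subst hi; exact hg.2.2)
      refine (h1.add hD h0 ((sf.pd2 hD).mul sg) (sf.mul (sg.pd2 hD)) h2).congr ?_
      filter_upwards [hD.mem_nhds h0] with x hx
      rw [pd2_mul (sf.differentiableAt_of_isOpen hD hx) (sg.differentiableAt_of_isOpen hD hx)]

lemma Flat.const_mul (hD : IsOpen D) (h0 : (0 : ℝ × ℝ) ∈ D) (sf : ContDiffOn ℝ (⊤ : ℕ∞) f D)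
    (hf : Flat k f) (c : ℝ) : Flat k (fun x => c * f x) := by
  simpa using Flat.mul hD h0 (contDiffOn_const (c := c)) sf (j := 0) trivial hf

/-- A smooth function vanishing to order `k` at the origin is `O(‖x‖ ^ k)`;
stated with `o` of one power less. -/
lemma Flat.isLittleO (hD : IsOpen D) (h0 : (0 : ℝ × ℝ) ∈ D) (sf : ContDiffOn ℝ (⊤ : ℕ∞) f D)
    (hf : Flat (k + 1) f) : f =o[nhds 0] fun x : ℝ × ℝ => ‖x‖ ^ k := by
  induction k generalizing f with
  | zero =>
    have hc : ContinuousAt f 0 := (sf.contDiffAt (hD.mem_nhds h0)).continuousAt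
    simp only [pow_zero]
    rw [isLittleO_one_iff]
    simpa [hf.1] using hc.tendsto
  | succ k ih =>
    refine isLittleO_pow_succ_of_pd ?_ hf.1 (ih (sf.pd1 hD) hf.2.1) (ih (sf.pd2 hD) hf.2.2)
    filter_upwards [hD.mem_nhds h0] with x hx using sf.differentiableAt_of_isOpen hD hx

end Flat

section LeadingTerm

variable {D : Set (ℝ × ℝ)}

lemma hasFDerivAt_mul_pow (μ : ℂ) (m : ℕ) (x : ℝ × ℝ) :
    HasFDerivAt (fun y : ℝ × ℝ => μ * ((y.1 : ℂ) + (y.2 : ℂ) * Complex.I) ^ (m + 1))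
      (((ContinuousLinearMap.toSpanSingleton ℂ
        (μ * ((m + 1 : ℕ) * ((x.1 : ℂ) + (x.2 : ℂ) * Complex.I) ^ m))).restrictScalars ℝ).comp
        (Complex.equivRealProdCLM.symm : ℝ × ℝ →L[ℝ] ℂ)) x := by
  have h1 : HasDerivAt (fun z : ℂ => μ * z ^ (m + 1))
      (μ * ((m + 1 : ℕ) * ((x.1 : ℂ) + (x.2 : ℂ) * Complex.I) ^ m))
      (Complex.equivRealProdCLM.symm x) := by
    simpa [Complex.equivRealProdCLM_symm_apply] using
      (hasDerivAt_pow (m + 1) (Complex.equivRealProdCLM.symm x)).const_mul μ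
  have h2 := (h1.hasFDerivAt.restrictScalars ℝ).comp x
    (Complex.equivRealProdCLM.symm : ℝ × ℝ →L[ℝ] ℂ).hasFDerivAt
  refine h2.congr_of_eventuallyEq (Eventually.of_forall fun y => ?_)
  simp only [Function.comp_apply,
    Complex.equivRealProdCLM_symm_apply]

lemma hasFDerivAt_re_mul_pow (μ : ℂ) (m : ℕ) (x : ℝ × ℝ) :
    DifferentiableAt ℝ
      (fun y : ℝ × ℝ => (μ * ((y.1 : ℂ) + (y.2 : ℂ) * Complex.I) ^ (m + 1)).re) x ∧
    pd1 (fun y : ℝ × ℝ => (μ * ((y.1 : ℂ) + (y.2 : ℂ) * Complex.I) ^ (m + 1)).re) x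
      = ((m + 1 : ℕ) * μ * ((x.1 : ℂ) + (x.2 : ℂ) * Complex.I) ^ m).re ∧
    pd2 (fun y : ℝ × ℝ => (μ * ((y.1 : ℂ) + (y.2 : ℂ) * Complex.I) ^ (m + 1)).re) x
      = -((m + 1 : ℕ) * μ * ((x.1 : ℂ) + (x.2 : ℂ) * Complex.I) ^ m).im := by
  have h := Complex.reCLM.hasFDerivAt.comp x (hasFDerivAt_mul_pow μ m x)
  refine ⟨h.differentiableAt, ?_, ?_⟩
  · refine (congrArg (fun T : ℝ × ℝ →L[ℝ] ℝ => T (1, 0)) h.fderiv).trans ?_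
    simp [Complex.equivRealProdCLM_symm_apply]
    ring
  · refine (congrArg (fun T : ℝ × ℝ →L[ℝ] ℝ => T (0, 1)) h.fderiv).trans ?_
    simp [Complex.equivRealProdCLM_symm_apply]
    ring

lemma hasFDerivAt_im_mul_pow (μ : ℂ) (m : ℕ) (x : ℝ × ℝ) :
    DifferentiableAt ℝ
      (fun y : ℝ × ℝ => (μ * ((y.1 : ℂ) + (y.2 : ℂ) * Complex.I) ^ (m + 1)).im) x ∧
    pd1 (fun y : ℝ × ℝ => (μ * ((y.1 : ℂ) + (y.2 : ℂ) * Complex.I) ^ (m + 1)).im) x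
      = ((m + 1 : ℕ) * μ * ((x.1 : ℂ) + (x.2 : ℂ) * Complex.I) ^ m).im ∧
    pd2 (fun y : ℝ × ℝ => (μ * ((y.1 : ℂ) + (y.2 : ℂ) * Complex.I) ^ (m + 1)).im) x
      = ((m + 1 : ℕ) * μ * ((x.1 : ℂ) + (x.2 : ℂ) * Complex.I) ^ m).re := by
  have h := Complex.imCLM.hasFDerivAt.comp x (hasFDerivAt_mul_pow μ m x)
  refine ⟨h.differentiableAt, ?_, ?_⟩
  · refine (congrArg (fun T : ℝ × ℝ →L[ℝ] ℝ => T (1, 0)) h.fderiv).trans ?_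
    simp [Complex.equivRealProdCLM_symm_apply]
    ring
  · refine (congrArg (fun T : ℝ × ℝ →L[ℝ] ℝ => T (0, 1)) h.fderiv).trans ?_
    simp [Complex.equivRealProdCLM_symm_apply]
    ring

/-- Leading term at the origin of an approximate solution `f₁ - i f₂` of the Cauchy-Riemann
equations. -/
lemma exists_leading_term_of_cauchyRiemann (hD : IsOpen D) (h0 : (0 : ℝ × ℝ) ∈ D) (m : ℕ)
    {f₁ f₂ : ℝ × ℝ → ℝ}
    (s₁ : ContDiffOn ℝ (⊤ : ℕ∞) f₁ D) (s₂ : ContDiffOn ℝ (⊤ : ℕ∞) f₂ D)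
    (hf₁ : Flat m f₁) (hf₂ : Flat m f₂)
    (c₁ : Flat m fun x => pd1 f₁ x + pd2 f₂ x) (c₂ : Flat m fun x => pd2 f₁ x - pd1 f₂ x) :
    ∃ μ : ℂ,
      (fun x : ℝ × ℝ => f₁ x - (μ * ((x.1 : ℂ) + (x.2 : ℂ) * Complex.I) ^ m).re)
        =o[nhds 0] (fun x : ℝ × ℝ => ‖x‖ ^ m) ∧
      (fun x : ℝ × ℝ => f₂ x + (μ * ((x.1 : ℂ) + (x.2 : ℂ) * Complex.I) ^ m).im)
        =o[nhds 0] (fun x : ℝ × ℝ => ‖x‖ ^ m) ∧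
      (μ = 0 → Flat (m + 1) f₁ ∧ Flat (m + 1) f₂) := by
  induction m generalizing f₁ f₂ with
  | zero =>
    refine ⟨⟨f₁ 0, -f₂ 0⟩, ?_, ?_, fun h => ?_⟩
    · have hc : ContinuousAt f₁ 0 := (s₁.contDiffAt (hD.mem_nhds h0)).continuousAt
      simp only [pow_zero, mul_one, isLittleO_one_iff]
      simpa using hc.tendsto.sub_const (f₁ 0)
    · have hc : ContinuousAt f₂ 0 := (s₂.contDiffAt (hD.mem_nhds h0)).continuousAt
      simp only [pow_zero, mul_one, isLittleO_one_iff]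
      simpa using hc.tendsto.add_const (-f₂ 0)
    · have h1 := congrArg Complex.re h
      have h2 := congrArg Complex.im h
      simp only [Complex.zero_re, Complex.zero_im, neg_eq_zero] at h1 h2
      exact ⟨⟨h1, trivial, trivial⟩, ⟨h2, trivial, trivial⟩⟩
  | succ m ih =>
    have d₁ {x} (hx : x ∈ D) := s₁.differentiableAt_of_isOpen hD hx
    have d₂ {x} (hx : x ∈ D) := s₂.differentiableAt_of_isOpen hD hx
    have e₁ : pd1 (fun x => pd1 f₁ x + pd2 f₂ x) =ᶠ[nhds 0]
        fun x => pd1 (pd1 f₁) x + pd2 (pd1 f₂) x := by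
      filter_upwards [hD.mem_nhds h0] with x hx
      rw [pd1_add ((s₁.pd1 hD).differentiableAt_of_isOpen hD hx)
        ((s₂.pd2 hD).differentiableAt_of_isOpen hD hx), pd1_pd2_comm s₂ hD hx]
    have e₂ : pd1 (fun x => pd2 f₁ x - pd1 f₂ x) =ᶠ[nhds 0]
        fun x => pd2 (pd1 f₁) x - pd1 (pd1 f₂) x := by
      filter_upwards [hD.mem_nhds h0] with x hx
      rw [pd1_sub ((s₁.pd2 hD).differentiableAt_of_isOpen hD hx)
        ((s₂.pd1 hD).differentiableAt_of_isOpen hD hx), pd1_pd2_comm s₁ hD hx]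
    obtain ⟨μ, h₁, h₂, hμ⟩ := ih (s₁.pd1 hD) (s₂.pd1 hD) hf₁.2.1 hf₂.2.1
      (c₁.2.1.congr e₁) (c₂.2.1.congr e₂)
    have hm : ((m + 1 : ℕ) : ℂ) ≠ 0 := by exact_mod_cast m.succ_ne_zero
    have hμm : ((m + 1 : ℕ) : ℂ) * (μ / (m + 1 : ℕ)) = μ := by field_simp
    have sc₁ := ((s₁.pd1 hD).add (s₂.pd2 hD))
    have sc₂ := ((s₁.pd2 hD).sub (s₂.pd1 hD))
    have o₁ := c₁.isLittleO hD h0 sc₁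
    have o₂ := c₂.isLittleO hD h0 sc₂
    have F₁ := fun x => hasFDerivAt_re_mul_pow (μ / (m + 1 : ℕ)) m x
    have F₂ := fun x => hasFDerivAt_im_mul_pow (μ / (m + 1 : ℕ)) m x
    simp only [hμm] at F₁ F₂
    refine ⟨μ / (m + 1 : ℕ), ?_, ?_, fun h => ?_⟩
    · refine isLittleO_pow_succ_of_pd ?_ (by simp [hf₁.1]) ?_ ?_
      · filter_upwards [hD.mem_nhds h0] with x hx using (d₁ hx).sub (F₁ x).1
      · refine h₁.congr' ?_ EventuallyEq.rfl
        filter_upwards [hD.mem_nhds h0] with x hx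
        rw [pd1_sub (d₁ hx) (F₁ x).1, (F₁ x).2.1]
      · refine (h₂.add o₂).congr' ?_ EventuallyEq.rfl
        filter_upwards [hD.mem_nhds h0] with x hx
        rw [pd2_sub (d₁ hx) (F₁ x).1, (F₁ x).2.2]
        ring
    · refine isLittleO_pow_succ_of_pd ?_ (by simp [hf₂.1]) ?_ ?_
      · filter_upwards [hD.mem_nhds h0] with x hx using (d₂ hx).add (F₂ x).1
      · refine h₂.congr' ?_ EventuallyEq.rfl
        filter_upwards [hD.mem_nhds h0] with x hx
        rw [pd1_add (d₂ hx) (F₂ x).1, (F₂ x).2.1]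
      · refine (o₁.sub h₁).congr' ?_ EventuallyEq.rfl
        filter_upwards [hD.mem_nhds h0] with x hx
        rw [pd2_add (d₂ hx) (F₂ x).1, (F₂ x).2.2]
        ring
    · have hμ0 : μ = 0 := by rw [← hμm, h, mul_zero]
      obtain ⟨g₁, g₂⟩ := hμ hμ0
      refine ⟨⟨hf₁.1, g₁, ?_⟩, ⟨hf₂.1, g₂, ?_⟩⟩
      · refine (c₂.add hD h0 sc₂ (s₂.pd1 hD) g₂).congr (Eventually.of_forall fun x => ?_)
        ring
      · refine (c₁.add hD h0 sc₁ ((s₁.pd1 hD).const_smul (-1 : ℝ))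
          (by simpa using g₁.const_mul hD h0 (s₁.pd1 hD) (-1))).congr
          (Eventually.of_forall fun x => ?_)
        simp

/-- A smooth function vanishing exactly to order `n` whose Laplacian vanishes to order `n - 1` has a
leading term which is a homogeneous harmonic polynomial. -/
lemma exists_leading_term_of_laplacian (hD : IsOpen D) (h0 : (0 : ℝ × ℝ) ∈ D) (n : ℕ)
    {w : ℝ × ℝ → ℝ} (sw : ContDiffOn ℝ (⊤ : ℕ∞) w D)
    (hw : Flat (n + 1) w) (hw' : ¬ Flat (n + 2) w)
    (hl : Flat n fun x => pd1 (pd1 w) x + pd2 (pd2 w) x) :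
    ∃ μ : ℂ, μ ≠ 0 ∧
      (fun x : ℝ × ℝ => w x - (μ * ((x.1 : ℂ) + (x.2 : ℂ) * Complex.I) ^ (n + 1)).re)
        =o[nhds 0] (fun x : ℝ × ℝ => ‖x‖ ^ (n + 1)) := by
  have hflat0 : Flat n fun _ => (0 : ℝ) := by
    simpa using hl.const_mul hD h0
      (((sw.pd1 hD).pd1 hD).add ((sw.pd2 hD).pd2 hD)) 0
  obtain ⟨μ, h₁, h₂, hμ⟩ := exists_leading_term_of_cauchyRiemann hD h0 n (sw.pd1 hD) (sw.pd2 hD)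
    hw.2.1 hw.2.2 hl (hflat0.congr (by
      filter_upwards [hD.mem_nhds h0] with x hx
      rw [pd1_pd2_comm sw hD hx, sub_self]))
  have hm : ((n + 1 : ℕ) : ℂ) ≠ 0 := by exact_mod_cast n.succ_ne_zero
  have hμm : ((n + 1 : ℕ) : ℂ) * (μ / (n + 1 : ℕ)) = μ := by field_simp
  have F₁ := fun x => hasFDerivAt_re_mul_pow (μ / (n + 1 : ℕ)) n x
  simp only [hμm] at F₁
  refine ⟨μ / (n + 1 : ℕ), fun h => hw' ?_, ?_⟩
  · have hμ0 : μ = 0 := by rw [← hμm, h, mul_zero]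
    exact ⟨hw.1, hμ hμ0⟩
  · have d {x} (hx : x ∈ D) := sw.differentiableAt_of_isOpen hD hx
    refine isLittleO_pow_succ_of_pd ?_ (by simp [hw.1]) ?_ ?_
    · filter_upwards [hD.mem_nhds h0] with x hx using (d hx).sub (F₁ x).1
    · refine h₁.congr' ?_ EventuallyEq.rfl
      filter_upwards [hD.mem_nhds h0] with x hx
      rw [pd1_sub (d hx) (F₁ x).1, (F₁ x).2.1]
    · refine h₂.congr' ?_ EventuallyEq.rfl
      filter_upwards [hD.mem_nhds h0] with x hx
      rw [pd2_sub (d hx) (F₁ x).1, (F₁ x).2.2]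
      ring

end LeadingTerm

section Frequency

lemma nonneg_of_deriv_nonneg_of_tendsto_atBot {f f' : ℝ → ℝ} {T : ℝ}
    (hf : ∀ t < T, HasDerivAt f (f' t) t) (hf' : ∀ t < T, 0 ≤ f' t)
    (hlim : Tendsto f atBot (nhds 0)) {t : ℝ} (ht : t < T) : 0 ≤ f t := by
  have hmono : MonotoneOn f (Iio T) := by
    refine monotoneOn_of_deriv_nonneg (convex_Iio T)
      (fun s hs => (hf s hs).continuousAt.continuousWithinAt)
      (fun s hs => (hf s (interior_subset (s := Iio T) hs)).differentiableAt.differentiableWithinAt)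
      fun s hs => ?_
    rw [(hf s (interior_subset (s := Iio T) hs)).deriv]
    exact hf' s (interior_subset (s := Iio T) hs)
  refine le_of_tendsto hlim ?_
  filter_upwards [eventually_le_atBot t] with s hs
  exact hmono (lt_of_le_of_lt hs ht) ht hs

/-- Almost-monotonicity of the frequency `E / H` in logarithmic time, in abstract form:
if `H` decays faster than every exponential at `-∞` then it vanishes. -/
lemma eq_zero_of_frequency {H E G h ε κ g : ℝ → ℝ} {T₀ C : ℝ} (hC : 0 ≤ C)
    (hH0 : ∀ t < T₀, 0 ≤ H t)
    (hH : ∀ t < T₀, HasDerivAt H (2 * E t + h t) t)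
    (hh : ∀ t < T₀, |h t| ≤ C * exp t * H t)
    (hE : ∀ t < T₀, HasDerivAt E (ε t) t) (hε : ∀ t < T₀, 0 ≤ ε t)
    (hεκ : ∀ t < T₀, ε t = 2 * κ t - G t) (hκ : ∀ t < T₀, 0 ≤ κ t)
    (hCS : ∀ t < T₀, E t ^ 2 ≤ H t * κ t)
    (hG : ∀ t < T₀, HasDerivAt G (g t) t) (hg : ∀ t < T₀, |g t| ≤ C * exp t * ε t)
    (limE : Tendsto E atBot (nhds 0)) (limG : Tendsto G atBot (nhds 0))
    (hdecay : ∀ N : ℕ, ∃ M, ∀ t < T₀, H t ≤ M * exp (N * t)) :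
    ∀ t < T₀, H t = 0 := by
  have E0 : ∀ t < T₀, 0 ≤ E t := fun t ht =>
    nonneg_of_deriv_nonneg_of_tendsto_atBot hE hε limE ht
  have limCE : Tendsto (fun t => C * exp t * E t) atBot (nhds 0) := by
    simpa using (tendsto_exp_atBot.const_mul C).mul limE
  have dCE : ∀ t < T₀, HasDerivAt (fun t => C * exp t * E t)
      (C * exp t * E t + C * exp t * ε t) t := fun t ht =>
    ((Real.hasDerivAt_exp t).const_mul C).mul (hE t ht)
  have GE : ∀ t < T₀, G t ≤ C * exp t * E t := by
    intro t ht
    have := nonneg_of_deriv_nonneg_of_tendsto_atBot (fun t ht => (dCE t ht).sub (hG t ht))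
      (fun t ht => ?_) (sub_zero (0 : ℝ) ▸ limCE.sub limG) ht
    · simpa using this
    · have h1 := (abs_le.1 (hg t ht)).2
      have h2 : 0 ≤ C * exp t * E t := by have := E0 t ht; positivity
      linarith
  intro T hT
  by_contra hne
  have HT : 0 < H T := lt_of_le_of_ne (hH0 T hT) (Ne.symm hne)
  set K₀ : ℝ := E T / H T * exp (2 * C * exp T) with hK₀
  set K : ℝ := 2 * K₀ + C * exp T with hK
  have ratio : ∀ δ > 0, ∀ s ≤ T, E s ≤ K₀ * (H s + δ) := by
    intro δ hδ s hs
    have Hpos : ∀ t < T₀, 0 < H t + δ := fun t ht => by have := hH0 t ht; linarith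
    have dΦ : ∀ t < T₀, HasDerivAt (fun t => E t / (H t + δ) * exp (2 * C * exp t))
        ((ε t * (H t + δ) - E t * (2 * E t + h t)) / (H t + δ) ^ 2 * exp (2 * C * exp t)
          + E t / (H t + δ) * (exp (2 * C * exp t) * (2 * C * exp t))) t := fun t ht =>
      ((hE t ht).div ((hH t ht).add_const δ) (Hpos t ht).ne').mul
        (((Real.hasDerivAt_exp t).const_mul (2 * C)).exp)
    have mono : MonotoneOn (fun t => E t / (H t + δ) * exp (2 * C * exp t)) (Iio T₀) := by
      refine monotoneOn_of_deriv_nonneg (convex_Iio _)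
        (fun s hs => (dΦ s hs).continuousAt.continuousWithinAt)
        (fun s hs => (dΦ s (interior_subset (s := Iio T₀) hs)).differentiableAt.differentiableWithinAt)
        fun t ht => ?_
      have ht' : t < T₀ := interior_subset (s := Iio T₀) ht
      rw [(dΦ t ht').deriv]
      have hp := Hpos t ht'
      have key : 0 ≤ ε t * (H t + δ) - E t * (2 * E t + h t)
          + 2 * C * exp t * (E t * (H t + δ)) := by
        have e0 := E0 t ht'
        have hce : 0 ≤ C * exp t := by positivity
        have i1 : E t * h t ≤ E t * (C * exp t * (H t + δ)) :=
          mul_le_mul_of_nonneg_left ((le_abs_self _).trans ((hh t ht').trans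
            (mul_le_mul_of_nonneg_left (by linarith) hce))) e0
        have i2 : G t * (H t + δ) ≤ C * exp t * E t * (H t + δ) :=
          mul_le_mul_of_nonneg_right (GE t ht') hp.le
        have i3 := hCS t ht'
        have i4 : 0 ≤ κ t * δ := mul_nonneg (hκ t ht') hδ.le
        rw [hεκ t ht']
        nlinarith
      have : (ε t * (H t + δ) - E t * (2 * E t + h t)) / (H t + δ) ^ 2 * exp (2 * C * exp t)
          + E t / (H t + δ) * (exp (2 * C * exp t) * (2 * C * exp t))
          = (ε t * (H t + δ) - E t * (2 * E t + h t)
          + 2 * C * exp t * (E t * (H t + δ))) * exp (2 * C * exp t) / (H t + δ) ^ 2 := by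
        field_simp
      rw [this]
      positivity
    have h1 := mono (lt_of_le_of_lt hs hT) hT hs
    have hsT := lt_of_le_of_lt hs hT
    have h2 : E s / (H s + δ) ≤ K₀ := by
      calc E s / (H s + δ) ≤ E s / (H s + δ) * exp (2 * C * exp s) :=
            le_mul_of_one_le_right (div_nonneg (E0 s hsT) (Hpos s hsT).le)
              (Real.one_le_exp (by positivity))
        _ ≤ _ := h1
        _ ≤ K₀ := by
            have := E0 T hT
            change E T / (H T + δ) * exp (2 * C * exp T) ≤ E T / H T * exp (2 * C * exp T)
            gcongr
            linarith
    exact (div_le_iff₀ (Hpos s hsT)).1 h2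
  have growth : ∀ s ≤ T, H T * exp (-K * T) ≤ H s * exp (-K * s) := by
    intro s hs
    have hδ : ∀ δ > 0, H T * exp (-K * T) ≤ H s * exp (-K * s) + δ * exp (-K * s) := by
      intro δ hδ
      have dΨ : ∀ t < T₀, HasDerivAt (fun t => (H t + δ) * exp (-K * t))
          ((2 * E t + h t) * exp (-K * t) + (H t + δ) * (exp (-K * t) * (-K * 1))) t := fun t ht =>
        ((hH t ht).add_const δ).mul (((hasDerivAt_id t).const_mul (-K)).exp)
      have anti : AntitoneOn (fun t => (H t + δ) * exp (-K * t)) (Iic T) := by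
        refine antitoneOn_of_deriv_nonpos (convex_Iic _)
          (fun s hs => (dΨ s (lt_of_le_of_lt hs hT)).continuousAt.continuousWithinAt)
          (fun s hs => (dΨ s (lt_of_le_of_lt (interior_subset (s := Iic T) hs)
            hT)).differentiableAt.differentiableWithinAt)
          fun t ht => ?_
        have htT : t ≤ T := interior_subset (s := Iic T) ht
        have ht' : t < T₀ := lt_of_le_of_lt htT hT
        rw [(dΨ t ht').deriv]
        have h1 : h t ≤ C * exp T * (H t + δ) := by
          have h2 := (le_abs_self _).trans (hh t ht')
          have h3 := hH0 t ht'
          refine h2.trans ?_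
          gcongr
          linarith
        have h2 := ratio δ hδ t htT
        have h3 : 2 * E t + h t ≤ K * (H t + δ) := by rw [hK]; linarith
        have := mul_le_mul_of_nonneg_right h3 (exp_pos (-K * t)).le
        linarith
      have h1 : (H T + δ) * exp (-K * T) ≤ (H s + δ) * exp (-K * s) :=
        anti (show s ∈ Iic T from hs) (mem_Iic.2 le_rfl) hs
      have h2 : 0 ≤ δ * exp (-K * T) := by positivity
      linarith
    refine le_of_forall_pos_le_add fun η hη => ?_
    have := hδ (η / exp (-K * s)) (by positivity)
    rwa [div_mul_cancel₀ _ (exp_pos _).ne'] at this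
  obtain ⟨N, hN⟩ := exists_nat_gt K
  obtain ⟨M, hM⟩ := hdecay N
  have lim : Tendsto (fun s => M * exp ((N - K) * s)) atBot (nhds 0) := by
    have h1 : Tendsto (fun s : ℝ => (N - K) * s) atBot atBot :=
      tendsto_id.const_mul_atBot (by linarith)
    simpa using (tendsto_exp_atBot.comp h1).const_mul M
  have hle : H T * exp (-K * T) ≤ 0 := by
    refine ge_of_tendsto lim ?_
    filter_upwards [eventually_le_atBot T] with s hs
    calc _ ≤ H s * exp (-K * s) := growth s hs
      _ ≤ M * exp (N * s) * exp (-K * s) := by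
          gcongr
          exact hM s (lt_of_le_of_lt hs hT)
      _ = M * exp ((N - K) * s) := by
          rw [mul_assoc, ← exp_add]
          ring_nf
  have : 0 < H T * exp (-K * T) := by positivity
  linarith

end Frequency

section Strip

/-- The half-plane `t < T₀` in logarithmic polar coordinates `(t, θ)`. -/
def strip (T₀ : ℝ) : Set (ℝ × ℝ) := {z | z.1 < T₀}

variable {T₀ : ℝ} {f F r : ℝ × ℝ → ℝ}

lemma isOpen_strip : IsOpen (strip T₀) := isOpen_lt continuous_fst continuous_const

lemma ContDiffOn.continuous_slice (hf : ContDiffOn ℝ (⊤ : ℕ∞) f (strip T₀)) {t : ℝ} (ht : t < T₀) :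
    Continuous fun θ : ℝ => f (t, θ) :=
  hf.continuousOn.comp_continuous (by fun_prop) fun _ => ht

lemma pd1_add_period {τ : ℝ × ℝ} (hf : ∀ z, f (z + τ) = f z) (z : ℝ × ℝ) :
    pd1 f (z + τ) = pd1 f z := by
  have h : (fun y => f (y + τ)) = f := funext hf
  conv_rhs => rw [← h]
  simp only [pd1, fderiv_comp_add_right]

lemma pd2_add_period {τ : ℝ × ℝ} (hf : ∀ z, f (z + τ) = f z) (z : ℝ × ℝ) :
    pd2 f (z + τ) = pd2 f z := by
  have h : (fun y => f (y + τ)) = f := funext hf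
  conv_rhs => rw [← h]
  simp only [pd2, fderiv_comp_add_right]

lemma hasDerivAt_slice1 {z : ℝ × ℝ} (hf : DifferentiableAt ℝ f z) :
    HasDerivAt (fun s => f (s, z.2)) (pd1 f z) z.1 :=
  hf.hasFDerivAt.comp_hasDerivAt z.1 ((hasDerivAt_id z.1).prodMk (hasDerivAt_const z.1 z.2))

lemma hasDerivAt_slice2 {z : ℝ × ℝ} (hf : DifferentiableAt ℝ f z) :
    HasDerivAt (fun s => f (z.1, s)) (pd2 f z) z.2 :=
  hf.hasFDerivAt.comp_hasDerivAt z.2 ((hasDerivAt_const z.2 z.1).prodMk (hasDerivAt_id z.2))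

/-- Flux identity: the derivative in `t` of the integral over a period of a current is the integral
of its divergence. -/
lemma hasDerivAt_integral_of_flux (hf : ContDiffOn ℝ (⊤ : ℕ∞) f (strip T₀))
    (hF : ContDiffOn ℝ (⊤ : ℕ∞) F (strip T₀)) (hper : ∀ z, F (z + (0, 2 * π)) = F z)
    (hr : ∀ z ∈ strip T₀, pd1 f z + pd2 F z = r z) {t : ℝ} (ht : t < T₀) :
    HasDerivAt (fun t => ∫ θ in (0)..(2 * π), f (t, θ)) (∫ θ in (0)..(2 * π), r (t, θ)) t := by
  have hf1 := hf.pd1 isOpen_strip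
  have hF2 := hF.pd2 isOpen_strip
  have hFint : ∫ θ in (0)..(2 * π), pd2 F (t, θ) = 0 := by
    rw [intervalIntegral.integral_eq_sub_of_hasDerivAt (f := fun θ => F (t, θ))
      (fun θ _ => hasDerivAt_slice2 (z := (t, θ)) (hF.differentiableAt_of_isOpen isOpen_strip ht))
      ((hF2.continuous_slice ht).intervalIntegrable _ _)]
    have := hper (t, 0)
    simp only [Prod.mk_add_mk, add_zero, zero_add] at this
    rw [this, sub_self]
  have hrint : ∫ θ in (0)..(2 * π), r (t, θ) = ∫ θ in (0)..(2 * π), pd1 f (t, θ) := by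
    have h := intervalIntegral.integral_add (a := 0) (b := 2 * π) (μ := MeasureTheory.volume)
      ((hf1.continuous_slice ht).intervalIntegrable _ _)
      ((hF2.continuous_slice ht).intervalIntegrable _ _)
    rw [hFint, add_zero] at h
    rw [← h]
    exact intervalIntegral.integral_congr fun θ _ => (hr (t, θ) ht).symm
  rw [hrint]
  obtain ⟨η, hη, hηT⟩ : ∃ η > 0, t + η < T₀ := ⟨(T₀ - t) / 2, by linarith, by linarith⟩
  have hK : IsCompact (Icc (t - η) (t + η) ×ˢ uIcc 0 (2 * π)) := isCompact_Icc.prod isCompact_uIcc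
  obtain ⟨B, hB⟩ := hK.exists_bound_of_continuousOn (f := pd1 f) (hf1.continuousOn.mono
    fun z hz => lt_of_le_of_lt hz.1.2 hηT)
  refine (intervalIntegral.hasDerivAt_integral_of_dominated_loc_of_deriv_le
    (F' := fun t θ => pd1 f (t, θ)) (bound := fun _ => B)
    (Icc_mem_nhds (by linarith : t - η < t) (by linarith : t < t + η)) ?_
    ((hf.continuous_slice ht).intervalIntegrable _ _)
    (hf1.continuous_slice ht).aestronglyMeasurable ?_ (by simp) ?_).2
  · filter_upwards [Iio_mem_nhds ht] with s hs
    exact (hf.continuous_slice hs).aestronglyMeasurable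
  · exact Eventually.of_forall fun θ hθ s hs => hB (s, θ) ⟨hs, uIoc_subset_uIcc hθ⟩
  · exact Eventually.of_forall fun θ _ s hs => hasDerivAt_slice1 (z := (s, θ))
      (hf.differentiableAt_of_isOpen isOpen_strip (lt_of_le_of_lt hs.2 hηT))

lemma abs_integral_le_mul_integral {f k : ℝ → ℝ} (hf : Continuous f) (hk : Continuous k) {c : ℝ}
    (h : ∀ θ, |f θ| ≤ c * k θ) :
    |∫ θ in (0)..(2 * π), f θ| ≤ c * ∫ θ in (0)..(2 * π), k θ := by
  rw [← intervalIntegral.integral_const_mul]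
  refine (intervalIntegral.abs_integral_le_integral_abs (by positivity)).trans ?_
  exact intervalIntegral.integral_mono_on (by positivity) (hf.abs.intervalIntegrable _ _)
    ((hk.const_mul c).intervalIntegrable _ _) fun θ _ => h θ

lemma tendsto_integral_atBot {C : ℝ}
    (h : ∀ t < T₀, ∀ θ, |f (t, θ)| ≤ C * exp t) :
    Tendsto (fun t => ∫ θ in (0)..(2 * π), f (t, θ)) atBot (nhds 0) := by
  have hlim : Tendsto (fun t => C * exp t * |2 * π - 0|) atBot (nhds 0) := by
    simpa using (tendsto_exp_atBot.const_mul C).mul_const |2 * π - 0|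
  refine squeeze_zero_norm' ?_ hlim
  filter_upwards [eventually_lt_atBot T₀] with t ht
  exact intervalIntegral.norm_integral_le_of_norm_le_const fun θ _ => h t ht θ

lemma abs_mul_le_mul {x y p q : ℝ} (hx : |x| ≤ p) (hy : |y| ≤ q) : |x * y| ≤ p * q := by
  rw [abs_mul]
  exact mul_le_mul hx hy (abs_nonneg _) ((abs_nonneg _).trans hx)

lemma quadratic_bounds {α β γ : ℝ} (hα : |α - 1| ≤ 1 / 4) (hβ : |β| ≤ 1 / 4)
    (hγ : |γ - 1| ≤ 1 / 4) (a c : ℝ) :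
    (a ^ 2 + c ^ 2) / 2 ≤ (α * a + β * c) * a + (β * a + γ * c) * c ∧
    |(α * a + β * c) * a + (β * a + γ * c) * c| ≤ 3 / 2 * (a ^ 2 + c ^ 2) ∧
    |(α * a + β * c) * c| ≤ 3 / 2 * (a ^ 2 + c ^ 2) ∧
    |(β * a + γ * c) * c| ≤ 3 / 2 * (a ^ 2 + c ^ 2) := by
  rw [abs_le] at hα hβ hγ
  obtain ⟨α₁, α₂⟩ := hα
  obtain ⟨β₁, β₂⟩ := hβ
  obtain ⟨γ₁, γ₂⟩ := hγ
  have p1 := mul_nonneg (sub_nonneg.2 α₁) (sq_nonneg a)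
  have p2 := mul_nonneg (sub_nonneg.2 α₂) (sq_nonneg a)
  have p3 := mul_nonneg (sub_nonneg.2 γ₁) (sq_nonneg c)
  have p4 := mul_nonneg (sub_nonneg.2 γ₂) (sq_nonneg c)
  have q1 := mul_nonneg (sub_nonneg.2 β₁) (sq_nonneg (a + c))
  have q2 := mul_nonneg (sub_nonneg.2 β₁) (sq_nonneg (a - c))
  have q3 := mul_nonneg (sub_nonneg.2 β₂) (sq_nonneg (a + c))
  have q4 := mul_nonneg (sub_nonneg.2 β₂) (sq_nonneg (a - c))
  have r1 := mul_nonneg (sub_nonneg.2 α₁) (sq_nonneg (a + c))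
  have r2 := mul_nonneg (sub_nonneg.2 α₁) (sq_nonneg (a - c))
  have r3 := mul_nonneg (sub_nonneg.2 α₂) (sq_nonneg (a + c))
  have r4 := mul_nonneg (sub_nonneg.2 α₂) (sq_nonneg (a - c))
  have s1 := mul_nonneg (sub_nonneg.2 β₁) (sq_nonneg c)
  have s2 := mul_nonneg (sub_nonneg.2 β₂) (sq_nonneg c)
  have t1 := sq_nonneg (a + c)
  have t2 := sq_nonneg (a - c)
  have t3 := sq_nonneg a
  have t4 := sq_nonneg c
  refine ⟨by nlinarith, abs_le.2 ⟨by nlinarith, by nlinarith⟩, abs_le.2 ⟨by nlinarith, by nlinarith⟩,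
    abs_le.2 ⟨by nlinarith, by nlinarith⟩⟩

lemma abs_quadratic_le {x y z m : ℝ} (hx : |x| ≤ m) (hy : |y| ≤ m) (hz : |z| ≤ m) (a c : ℝ) :
    |x * a ^ 2 + 2 * y * (a * c) + z * c ^ 2| ≤ 2 * m * (a ^ 2 + c ^ 2) := by
  have hm : 0 ≤ m := (abs_nonneg x).trans hx
  have h1 := abs_mul_le_mul hx (abs_of_nonneg (sq_nonneg a)).le
  have h2 : |y * (2 * (a * c))| ≤ m * (a ^ 2 + c ^ 2) := by
    refine abs_mul_le_mul hy (abs_le.2 ⟨?_, ?_⟩)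
    · nlinarith [sq_nonneg (a + c)]
    · nlinarith [sq_nonneg (a - c)]
  have h3 := abs_mul_le_mul hz (abs_of_nonneg (sq_nonneg c)).le
  rw [abs_le] at *
  constructor <;> nlinarith

/-- The divergence of the Noether current is controlled by the energy density. -/
lemma noether_error_bound {α β γ b α₁ β₁ γ₁ b₁ α₂ β₂ γ₂ b₂ m : ℝ} (hα : |α - 1| ≤ 1 / 4)
    (hβ : |β| ≤ 1 / 4) (hγ : |γ - 1| ≤ 1 / 4) (hb : |b| ≤ 1 / 2)
    (hα₁ : |α₁| ≤ m) (hβ₁ : |β₁| ≤ m) (hγ₁ : |γ₁| ≤ m) (hb₁ : |b₁| ≤ 2 * m)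
    (hα₂ : |α₂| ≤ m) (hβ₂ : |β₂| ≤ m) (hγ₂ : |γ₂| ≤ m) (hb₂ : |b₂| ≤ 2 * m) (a c : ℝ) :
    |2 * b₁ * ((α * a + β * c) * c) + 2 * b₂ * ((β * a + γ * c) * c)
      - b₂ * ((α * a + β * c) * a + (β * a + γ * c) * c)
      - (α₁ * a ^ 2 + 2 * β₁ * (a * c) + γ₁ * c ^ 2)
      - b * (α₂ * a ^ 2 + 2 * β₂ * (a * c) + γ₂ * c ^ 2)|
      ≤ 40 * m * ((α * a + β * c) * a + (β * a + γ * c) * c) := by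
  have hm : 0 ≤ m := (abs_nonneg _).trans hα₁
  obtain ⟨e0, e1, e2, e3⟩ := quadratic_bounds hα hβ hγ a c
  have t1 := abs_mul_le_mul hb₁ e2
  have t2 := abs_mul_le_mul hb₂ e3
  have t3 := abs_mul_le_mul hb₂ e1
  have t4 := abs_quadratic_le hα₁ hβ₁ hγ₁ a c
  have t5 := abs_mul_le_mul hb (abs_quadratic_le hα₂ hβ₂ hγ₂ a c)
  have e4 := mul_le_mul_of_nonneg_left e0 (by positivity : 0 ≤ 40 * m)
  have e5 : 0 ≤ m * (a ^ 2 + c ^ 2) := by positivity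
  refine le_trans ?_ e4
  rw [abs_le] at t1 t2 t3 t4 t5 ⊢
  constructor <;> linarith

lemma abs_quotient_deriv_le {α b α₁ β₁ b₁ m : ℝ} (hα : |α - 1| ≤ 1 / 4) (hb : |b| ≤ 1 / 2)
    (hα₁ : |α₁| ≤ m) (hβ₁ : |β₁| ≤ m) (h : β₁ = α₁ * b + α * b₁) : |b₁| ≤ 2 * m := by
  have h1 := abs_mul_le_mul hα₁ hb
  have h2 : α * b₁ = β₁ - α₁ * b := by linarith
  have h3 : |α * b₁| ≤ 3 / 2 * m := by
    rw [h2]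
    rw [abs_le] at *
    constructor <;> linarith
  rw [abs_mul] at h3
  have h4 : 3 / 4 ≤ |α| := le_trans (by linarith [(abs_le.1 hα).1]) (le_abs_self α)
  nlinarith [abs_nonneg b₁]

end Strip

section StripUniqueContinuation

variable {T₀ : ℝ}

lemma eq_zero_of_integral_eq_zero {f : ℝ → ℝ} (hf : Continuous f) (h0 : ∀ θ, 0 ≤ f θ)
    (hper : ∀ θ, f (θ + 2 * π) = f θ) (hint : ∫ θ in (0)..(2 * π), f θ = 0) (θ : ℝ) : f θ = 0 := by
  obtain ⟨y, hy, hfy⟩ := Function.Periodic.exists_mem_Ico₀ (f := f) hper two_pi_pos θ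
  by_contra hne
  have hpos : 0 < f y := hfy ▸ (h0 θ).lt_of_ne' hne
  exact (intervalIntegral.integral_pos two_pi_pos hf.continuousOn (fun x _ => h0 x)
    ⟨y, Ico_subset_Icc_self hy, hpos⟩).ne' hint

/-- Strong unique continuation in logarithmic polar coordinates: a solution of
`∂ₜ(α Wₜ + β W_θ) + ∂_θ(β Wₜ + γ W_θ) = 0`, with coefficients exponentially close to those of the
Laplacian, which decays faster than every exponential as `t → -∞` vanishes identically. -/
lemma eq_zero_on_strip {W α β γ : ℝ × ℝ → ℝ} {M : ℝ}
    (sW : ContDiffOn ℝ (⊤ : ℕ∞) W (strip T₀)) (sα : ContDiffOn ℝ (⊤ : ℕ∞) α (strip T₀))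
    (sβ : ContDiffOn ℝ (⊤ : ℕ∞) β (strip T₀)) (sγ : ContDiffOn ℝ (⊤ : ℕ∞) γ (strip T₀))
    (pW : ∀ z, W (z + (0, 2 * π)) = W z) (pα : ∀ z, α (z + (0, 2 * π)) = α z)
    (pβ : ∀ z, β (z + (0, 2 * π)) = β z) (pγ : ∀ z, γ (z + (0, 2 * π)) = γ z)
    (hα : ∀ z ∈ strip T₀, |α z - 1| ≤ 1 / 4) (hβ : ∀ z ∈ strip T₀, |β z| ≤ 1 / 4)
    (hγ : ∀ z ∈ strip T₀, |γ z - 1| ≤ 1 / 4)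
    (hα₁ : ∀ z ∈ strip T₀, |pd1 α z| ≤ M * exp z.1) (hα₂ : ∀ z ∈ strip T₀, |pd2 α z| ≤ M * exp z.1)
    (hβ₁ : ∀ z ∈ strip T₀, |pd1 β z| ≤ M * exp z.1) (hβ₂ : ∀ z ∈ strip T₀, |pd2 β z| ≤ M * exp z.1)
    (hγ₁ : ∀ z ∈ strip T₀, |pd1 γ z| ≤ M * exp z.1) (hγ₂ : ∀ z ∈ strip T₀, |pd2 γ z| ≤ M * exp z.1)
    (hW : ∀ z ∈ strip T₀, |W z| ≤ M) (hW₁ : ∀ z ∈ strip T₀, |pd1 W z| ≤ M * exp z.1)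
    (hW₂ : ∀ z ∈ strip T₀, |pd2 W z| ≤ M * exp z.1)
    (hdecay : ∀ N : ℕ, ∃ K, ∀ z ∈ strip T₀, W z ^ 2 ≤ K * exp (N * z.1))
    (hpde : ∀ z ∈ strip T₀, pd1 (fun z => α z * pd1 W z + β z * pd2 W z) z
      + pd2 (fun z => β z * pd1 W z + γ z * pd2 W z) z = 0) :
    ∀ z ∈ strip T₀, W z = 0 := by
  rcases (strip T₀).eq_empty_or_nonempty with he | ⟨z₀, hz₀⟩
  · simp [he]
  have hM : 0 ≤ M := (abs_nonneg _).trans (hW z₀ hz₀)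
  have hO := isOpen_strip (T₀ := T₀)
  have αpos : ∀ z ∈ strip T₀, 3 / 4 ≤ α z := fun z hz => by linarith [(abs_le.1 (hα z hz)).1]
  have sa := sW.pd1 hO
  have sc := sW.pd2 hO
  set b : ℝ × ℝ → ℝ := fun z => β z / α z with hb_def
  have sb : ContDiffOn ℝ (⊤ : ℕ∞) b (strip T₀) :=
    sβ.div sα fun z hz => by linarith [αpos z hz]
  have hαb : ∀ z ∈ strip T₀, β z = α z * b z := fun z hz => by
    have := αpos z hz
    rw [hb_def]
    field_simp
  have hb : ∀ z ∈ strip T₀, |b z| ≤ 1 / 2 := fun z hz => by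
    have h1 := αpos z hz
    rw [hb_def, abs_div, abs_of_pos (by linarith : 0 < α z), div_le_iff₀ (by linarith)]
    linarith [hβ z hz]
  set P : ℝ × ℝ → ℝ := fun z => α z * pd1 W z + β z * pd2 W z with hP
  set Q : ℝ × ℝ → ℝ := fun z => β z * pd1 W z + γ z * pd2 W z with hQ
  set V : ℝ × ℝ → ℝ := fun z => pd1 W z + b z * pd2 W z with hV
  have sP : ContDiffOn ℝ (⊤ : ℕ∞) P (strip T₀) := (sα.mul sa).add (sβ.mul sc)
  have sQ : ContDiffOn ℝ (⊤ : ℕ∞) Q (strip T₀) := (sβ.mul sa).add (sγ.mul sc)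
  have sV : ContDiffOn ℝ (⊤ : ℕ∞) V (strip T₀) := sa.add (sb.mul sc)
  set e : ℝ × ℝ → ℝ := fun z => P z * pd1 W z + Q z * pd2 W z with he
  have se : ContDiffOn ℝ (⊤ : ℕ∞) e (strip T₀) := (sP.mul sa).add (sQ.mul sc)
  have PV : ∀ z ∈ strip T₀, P z = α z * V z := fun z hz => by
    simp only [hP, hV, hαb z hz]
    ring
  have ebd := fun z hz => quadratic_bounds (hα z hz) (hβ z hz) (hγ z hz) (pd1 W z) (pd2 W z)
  have pb : ∀ z, b (z + (0, 2 * π)) = b z := fun z => by simp only [hb_def, pα, pβ]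
  have pa := pd1_add_period pW
  have pc := pd2_add_period pW
  have pQ : ∀ z, Q (z + (0, 2 * π)) = Q z := fun z => by simp only [hQ, pβ, pγ, pa, pc]
  have pP : ∀ z, P (z + (0, 2 * π)) = P z := fun z => by simp only [hP, pα, pβ, pa, pc]
  -- the three currents
  set hr : ℝ × ℝ → ℝ := fun z => (pd1 α z + pd2 β z) * W z ^ 2 with hhr
  have shr : ContDiffOn ℝ (⊤ : ℕ∞) hr (strip T₀) :=
    ((sα.pd1 hO).add (sβ.pd2 hO)).mul (sW.pow 2)
  set J : ℝ × ℝ → ℝ := fun z => 2 * (P z * V z) - e z with hJ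
  have sJ : ContDiffOn ℝ (⊤ : ℕ∞) J (strip T₀) := (contDiffOn_const.mul (sP.mul sV)).sub se
  set gr : ℝ × ℝ → ℝ := fun z => 2 * pd1 b z * (P z * pd2 W z) + 2 * pd2 b z * (Q z * pd2 W z)
    - pd2 b z * e z
    - (pd1 α z * pd1 W z ^ 2 + 2 * pd1 β z * (pd1 W z * pd2 W z) + pd1 γ z * pd2 W z ^ 2)
    - b z * (pd2 α z * pd1 W z ^ 2 + 2 * pd2 β z * (pd1 W z * pd2 W z) + pd2 γ z * pd2 W z ^ 2)
    with hgr
  have sgr : ContDiffOn ℝ (⊤ : ℕ∞) gr (strip T₀) := by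
    have s1 := sb.pd1 hO
    have s2 := sb.pd2 hO
    have s3 := sα.pd1 hO
    have s4 := sα.pd2 hO
    have s5 := sβ.pd1 hO
    have s6 := sβ.pd2 hO
    have s7 := sγ.pd1 hO
    have s8 := sγ.pd2 hO
    fun_prop
  have dW {z} (hz : z ∈ strip T₀) := sW.differentiableAt_of_isOpen hO hz
  have dα {z} (hz : z ∈ strip T₀) := sα.differentiableAt_of_isOpen hO hz
  have dβ {z} (hz : z ∈ strip T₀) := sβ.differentiableAt_of_isOpen hO hz
  have dγ {z} (hz : z ∈ strip T₀) := sγ.differentiableAt_of_isOpen hO hz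
  have db {z} (hz : z ∈ strip T₀) := sb.differentiableAt_of_isOpen hO hz
  have da {z} (hz : z ∈ strip T₀) := sa.differentiableAt_of_isOpen hO hz
  have dc {z} (hz : z ∈ strip T₀) := sc.differentiableAt_of_isOpen hO hz
  have dP {z} (hz : z ∈ strip T₀) := sP.differentiableAt_of_isOpen hO hz
  have dQ {z} (hz : z ∈ strip T₀) := sQ.differentiableAt_of_isOpen hO hz
  have dV {z} (hz : z ∈ strip T₀) := sV.differentiableAt_of_isOpen hO hz
  have de {z} (hz : z ∈ strip T₀) := se.differentiableAt_of_isOpen hO hz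
  have P₁ : ∀ z ∈ strip T₀, pd1 P z = pd1 α z * pd1 W z + α z * pd1 (pd1 W) z
      + (pd1 β z * pd2 W z + β z * pd2 (pd1 W) z) := fun z hz => by
    rw [hP, pd1_add ((dα hz).fun_mul (da hz)) ((dβ hz).fun_mul (dc hz)), pd1_mul (dα hz) (da hz),
      pd1_mul (dβ hz) (dc hz), pd1_pd2_comm sW hO hz]
  have P₂ : ∀ z ∈ strip T₀, pd2 P z = pd2 α z * pd1 W z + α z * pd2 (pd1 W) z
      + (pd2 β z * pd2 W z + β z * pd2 (pd2 W) z) := fun z hz => by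
    rw [hP, pd2_add ((dα hz).fun_mul (da hz)) ((dβ hz).fun_mul (dc hz)), pd2_mul (dα hz) (da hz),
      pd2_mul (dβ hz) (dc hz)]
  have Q₁ : ∀ z ∈ strip T₀, pd1 Q z = pd1 β z * pd1 W z + β z * pd1 (pd1 W) z
      + (pd1 γ z * pd2 W z + γ z * pd2 (pd1 W) z) := fun z hz => by
    rw [hQ, pd1_add ((dβ hz).fun_mul (da hz)) ((dγ hz).fun_mul (dc hz)), pd1_mul (dβ hz) (da hz),
      pd1_mul (dγ hz) (dc hz), pd1_pd2_comm sW hO hz]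
  have Q₂ : ∀ z ∈ strip T₀, pd2 Q z = pd2 β z * pd1 W z + β z * pd2 (pd1 W) z
      + (pd2 γ z * pd2 W z + γ z * pd2 (pd2 W) z) := fun z hz => by
    rw [hQ, pd2_add ((dβ hz).fun_mul (da hz)) ((dγ hz).fun_mul (dc hz)), pd2_mul (dβ hz) (da hz),
      pd2_mul (dγ hz) (dc hz)]
  have fluxH : ∀ z ∈ strip T₀, pd1 (fun z => α z * (W z * W z)) z + pd2 (fun z => β z * (W z * W z)) z
      = 2 * (P z * W z) + hr z := fun z hz => by
    rw [pd1_mul (dα hz) ((dW hz).fun_mul (dW hz)), pd2_mul (dβ hz) ((dW hz).fun_mul (dW hz)),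
      pd1_mul (dW hz) (dW hz), pd2_mul (dW hz) (dW hz)]
    simp only [hP, hhr]
    ring
  have fluxE : ∀ z ∈ strip T₀, pd1 (fun z => P z * W z) z + pd2 (fun z => Q z * W z) z = e z :=
    fun z hz => by
    rw [pd1_mul (dP hz) (dW hz), pd2_mul (dQ hz) (dW hz)]
    simp only [he]
    linear_combination W z * hpde z hz
  have fluxG : ∀ z ∈ strip T₀, pd1 J z + pd2 (fun z => 2 * (Q z * V z) - b z * e z) z = gr z :=
    fun z hz => by
    rw [hJ, pd1_sub ((differentiableAt_const (2 : ℝ)).fun_mul ((dP hz).fun_mul (dV hz))) (de hz),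
      pd1_mul (differentiableAt_const (2 : ℝ)) ((dP hz).fun_mul (dV hz)), pd1_const,
      pd1_mul (dP hz) (dV hz),
      pd2_sub ((differentiableAt_const (2 : ℝ)).fun_mul ((dQ hz).fun_mul (dV hz))) ((db hz).fun_mul (de hz)),
      pd2_mul (differentiableAt_const (2 : ℝ)) ((dQ hz).fun_mul (dV hz)), pd2_const,
      pd2_mul (dQ hz) (dV hz), pd2_mul (db hz) (de hz), he,
      pd1_add ((dP hz).fun_mul (da hz)) ((dQ hz).fun_mul (dc hz)),
      pd2_add ((dP hz).fun_mul (da hz)) ((dQ hz).fun_mul (dc hz)),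
      pd1_mul (dP hz) (da hz), pd1_mul (dQ hz) (dc hz),
      pd2_mul (dP hz) (da hz), pd2_mul (dQ hz) (dc hz), hV,
      pd1_add (da hz) ((db hz).fun_mul (dc hz)), pd2_add (da hz) ((db hz).fun_mul (dc hz)),
      pd1_mul (db hz) (dc hz), pd2_mul (db hz) (dc hz), pd1_pd2_comm sW hO hz]
    have hp := hpde z hz
    rw [P₁ z hz, Q₂ z hz] at hp
    rw [P₁ z hz, P₂ z hz, Q₁ z hz, Q₂ z hz]
    simp only [hgr, he, hP, hQ]
    linear_combination 2 * (pd1 W z + b z * pd2 W z) * hp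
  have mem {t : ℝ} (ht : t < T₀) (θ : ℝ) : (t, θ) ∈ strip T₀ := ht
  have ii {f : ℝ × ℝ → ℝ} (sf : ContDiffOn ℝ (⊤ : ℕ∞) f (strip T₀)) {t : ℝ} (ht : t < T₀) :
      IntervalIntegrable (fun θ => f (t, θ)) MeasureTheory.volume 0 (2 * π) :=
    (sf.continuous_slice ht).intervalIntegrable _ _
  have two_pi : (0 : ℝ) ≤ 2 * π := by positivity
  have bt : ∀ z ∈ strip T₀, |pd1 b z| ≤ 2 * (M * exp z.1) := fun z hz => by
    refine abs_quotient_deriv_le (hα z hz) (hb z hz) (hα₁ z hz) (hβ₁ z hz) ?_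
    rw [← pd1_mul (dα hz) (db hz)]
    exact pd1_congr (by filter_upwards [hO.mem_nhds hz] with y hy using hαb y hy)
  have bθ : ∀ z ∈ strip T₀, |pd2 b z| ≤ 2 * (M * exp z.1) := fun z hz => by
    refine abs_quotient_deriv_le (hα z hz) (hb z hz) (hα₂ z hz) (hβ₂ z hz) ?_
    rw [← pd2_mul (dα hz) (db hz)]
    exact pd2_congr (by filter_upwards [hO.mem_nhds hz] with y hy using hαb y hy)
  have Pb : ∀ z ∈ strip T₀, |P z| ≤ 2 * (M * exp z.1) := fun z hz => by
    have h1 : |α z| ≤ 5 / 4 := by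
      have := abs_le.1 (hα z hz)
      exact abs_le.2 ⟨by linarith, by linarith⟩
    have h2 := abs_mul_le_mul h1 (hW₁ z hz)
    have h3 := abs_mul_le_mul (hβ z hz) (hW₂ z hz)
    have h4 : 0 ≤ M * exp z.1 := by positivity
    simp only [hP]
    exact (abs_add_le _ _).trans (by linarith)
  have zero := eq_zero_of_frequency (T₀ := T₀) (C := 40 * M)
    (H := fun t => ∫ θ in (0)..(2 * π), α (t, θ) * (W (t, θ) * W (t, θ)))
    (E := fun t => ∫ θ in (0)..(2 * π), P (t, θ) * W (t, θ))
    (G := fun t => ∫ θ in (0)..(2 * π), J (t, θ))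
    (h := fun t => ∫ θ in (0)..(2 * π), hr (t, θ))
    (ε := fun t => ∫ θ in (0)..(2 * π), e (t, θ))
    (κ := fun t => ∫ θ in (0)..(2 * π), P (t, θ) * V (t, θ))
    (g := fun t => ∫ θ in (0)..(2 * π), gr (t, θ)) (by positivity) ?_ ?_ ?_ ?_ ?_ ?_ ?_ ?_ ?_ ?_ ?_ ?_
    ?_
  · rintro ⟨t, θ₀⟩ hz
    have ht : t < T₀ := hz
    have h1 := eq_zero_of_integral_eq_zero ((sα.mul (sW.mul sW)).continuous_slice ht)
      (fun θ => mul_nonneg (by linarith [αpos _ (mem ht θ)]) (mul_self_nonneg _))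
      (fun θ => by
        have h2 := pα (t, θ)
        have h3 := pW (t, θ)
        simp only [Prod.mk_add_mk, add_zero] at h2 h3
        simp only [h2, h3]) (zero t ht) θ₀
    rcases mul_eq_zero.1 h1 with h2 | h2
    · linarith [αpos _ hz]
    · exact mul_self_eq_zero.1 h2
  · intro t ht
    refine intervalIntegral.integral_nonneg two_pi fun θ _ => ?_
    have := αpos _ (mem ht θ)
    have := mul_self_nonneg (W (t, θ))
    positivity
  · intro t ht
    have h1 := hasDerivAt_integral_of_flux (sα.mul (sW.mul sW)) (sβ.mul (sW.mul sW))
      (fun z => by simp only [pβ, pW]) fluxH ht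
    have h2 := intervalIntegral.integral_add (ii (contDiffOn_const (c := (2 : ℝ)).mul (sP.mul sW)) ht)
      (ii shr ht)
    rw [intervalIntegral.integral_const_mul] at h2
    rw [← h2]
    exact h1
  · intro t ht
    refine abs_integral_le_mul_integral (shr.continuous_slice ht)
      ((sα.mul (sW.mul sW)).continuous_slice ht) fun θ => ?_
    have hz := mem ht θ
    have h1 : |hr (t, θ)| ≤ (2 * (M * exp t)) * W (t, θ) ^ 2 := by
      refine abs_mul_le_mul ?_ (abs_of_nonneg (sq_nonneg _)).le
      have := abs_add_le (pd1 α (t, θ)) (pd2 β (t, θ))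
      linarith [hα₁ _ hz, hβ₂ _ hz]
    have h2 : 0 ≤ (M * exp t) * W (t, θ) ^ 2 := by positivity
    have h3 := mul_le_mul_of_nonneg_right (αpos _ hz) h2
    refine h1.trans ?_
    nlinarith
  · intro t ht
    exact hasDerivAt_integral_of_flux (sP.mul sW) (sQ.mul sW)
      (fun z => by simp only [pQ, pW]) fluxE ht
  · intro t ht
    refine intervalIntegral.integral_nonneg two_pi fun θ _ => ?_
    exact le_trans (by positivity) (ebd _ (mem ht θ)).1
  · intro t ht
    have h2 := intervalIntegral.integral_sub
      (ii (contDiffOn_const (c := (2 : ℝ)).mul (sP.mul sV)) ht) (ii sJ ht)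
    rw [intervalIntegral.integral_const_mul] at h2
    rw [← h2]
    refine intervalIntegral.integral_congr fun θ _ => ?_
    simp only [hJ]
    ring
  · intro t ht
    refine intervalIntegral.integral_nonneg two_pi fun θ _ => ?_
    rw [PV _ (mem ht θ)]
    have := αpos _ (mem ht θ)
    have := mul_self_nonneg (V (t, θ))
    rw [mul_assoc]
    positivity
  · intro t ht
    have hd : discrim (∫ θ in (0)..(2 * π), α (t, θ) * (W (t, θ) * W (t, θ)))
        (2 * ∫ θ in (0)..(2 * π), P (t, θ) * W (t, θ))
        (∫ θ in (0)..(2 * π), P (t, θ) * V (t, θ)) ≤ 0 := by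
      refine discrim_le_zero fun s => ?_
      have i1 := (ii (sα.mul (sW.mul sW)) ht).const_mul (s * s)
      have i2 := (ii (sP.mul sW) ht).const_mul (2 * s)
      have i3 := ii (sP.mul sV) ht
      have h0 : 0 ≤ ∫ θ in (0)..(2 * π), (s * s * (α (t, θ) * (W (t, θ) * W (t, θ)))
          + 2 * s * (P (t, θ) * W (t, θ)) + P (t, θ) * V (t, θ)) := by
        refine intervalIntegral.integral_nonneg two_pi fun θ _ => ?_
        rw [PV _ (mem ht θ)]
        have h1 : 0 ≤ α (t, θ) := by linarith [αpos _ (mem ht θ)]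
        have h2 := mul_nonneg h1 (sq_nonneg (s * W (t, θ) + V (t, θ)))
        linarith
      rw [intervalIntegral.integral_add (i1.add i2) i3, intervalIntegral.integral_add i1 i2,
        intervalIntegral.integral_const_mul, intervalIntegral.integral_const_mul] at h0
      linarith
    rw [discrim] at hd
    linarith
  · intro t ht
    exact hasDerivAt_integral_of_flux sJ ((contDiffOn_const.mul (sQ.mul sV)).sub (sb.mul se))
      (fun z => by simp only [he, hV, pQ, pP, pb, pa, pc]) fluxG ht
  · intro t ht
    refine abs_integral_le_mul_integral (sgr.continuous_slice ht) (se.continuous_slice ht)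
      fun θ => ?_
    have hz := mem ht θ
    have := noether_error_bound (hα _ hz) (hβ _ hz) (hγ _ hz) (hb _ hz) (hα₁ _ hz) (hβ₁ _ hz)
      (hγ₁ _ hz) (bt _ hz) (hα₂ _ hz) (hβ₂ _ hz) (hγ₂ _ hz) (bθ _ hz) (pd1 W (t, θ)) (pd2 W (t, θ))
    rw [mul_assoc (40 : ℝ)]
    exact this
  · refine tendsto_integral_atBot (T₀ := T₀) (f := fun z => P z * W z) (C := 2 * M * M)
      fun t ht θ => ?_
    have := abs_mul_le_mul (Pb _ (mem ht θ)) (hW _ (mem ht θ))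
    linarith
  · refine tendsto_integral_atBot (T₀ := T₀) (f := J) (C := 10 * (M * M * exp T₀))
      fun t ht θ => ?_
    have hz := mem ht θ
    have hVb : |V (t, θ)| ≤ 3 / 2 * (M * exp t) := by
      have h1 := abs_mul_le_mul (hb _ hz) (hW₂ _ hz)
      have h2 := hW₁ _ hz
      exact (abs_add_le _ _).trans (by linarith)
    have hPV := abs_mul_le_mul (Pb _ hz) hVb
    have he0 : 0 ≤ e (t, θ) := le_trans (by positivity) (ebd _ hz).1
    have h3 := sq_le_sq' (abs_le.1 (hW₁ _ hz)).1 (abs_le.1 (hW₁ _ hz)).2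
    have h4 := sq_le_sq' (abs_le.1 (hW₂ _ hz)).1 (abs_le.1 (hW₂ _ hz)).2
    have h5 : e (t, θ) ≤ 3 / 2 * (pd1 W (t, θ) ^ 2 + pd2 W (t, θ) ^ 2) :=
      (abs_le.1 (ebd _ hz).2.1).2
    have h6 : (M * exp t) ^ 2 ≤ M * M * exp T₀ * exp t := by
      have : exp t ≤ exp T₀ := exp_le_exp.2 ht.le
      calc (M * exp t) ^ 2 = M * M * exp t * exp t := by ring
        _ ≤ _ := by gcongr
    have h7 := abs_le.1 hPV
    simp only at h3 h4 h7
    simp only [hJ]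
    have h8 := sq_nonneg (M * exp t)
    rw [abs_le]
    constructor <;> linarith
  · intro N
    obtain ⟨K, hK⟩ := hdecay N
    refine ⟨5 / 4 * K * (2 * π), fun t ht => ?_⟩
    have h1 := intervalIntegral.norm_integral_le_of_norm_le_const
      (f := fun θ => α (t, θ) * (W (t, θ) * W (t, θ))) (a := 0) (b := 2 * π)
      (C := 5 / 4 * (K * exp (N * t))) fun θ _ => by
        have hz := mem ht θ
        have h1 : |α (t, θ)| ≤ 5 / 4 := by
          have := abs_le.1 (hα _ hz)
          exact abs_le.2 ⟨by linarith, by linarith⟩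
        refine abs_mul_le_mul h1 ?_
        rw [abs_of_nonneg (mul_self_nonneg _), ← pow_two]
        exact hK _ hz
    rw [sub_zero, abs_of_nonneg two_pi] at h1
    refine (le_abs_self _).trans (h1.trans (le_of_eq ?_))
    ring

end StripUniqueContinuation

section PolarCoordinates

/-- Logarithmic polar coordinates `(t, θ) ↦ eᵗ (cos θ, sin θ)`. -/
noncomputable def logPolar (z : ℝ × ℝ) : ℝ × ℝ := (exp z.1 * cos z.2, exp z.1 * sin z.2)

lemma contDiff_logPolar {n : WithTop ℕ∞} : ContDiff ℝ n logPolar := by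
  unfold logPolar
  fun_prop

lemma logPolar_add_period (z : ℝ × ℝ) : logPolar (z + (0, 2 * π)) = logPolar z := by
  simp [logPolar]

lemma norm_logPolar_le (z : ℝ × ℝ) : ‖logPolar z‖ ≤ exp z.1 := by
  have h := (exp_pos z.1).le
  simp only [logPolar, Prod.norm_def, norm_mul, Real.norm_eq_abs, abs_exp, max_le_iff]
  exact ⟨mul_le_of_le_one_right h (abs_cos_le_one _), mul_le_of_le_one_right h (abs_sin_le_one _)⟩

lemma exists_logPolar_eq {x : ℝ × ℝ} (hx : x ≠ 0) :
    ∃ z, logPolar z = x ∧ exp z.1 ≤ |x.1| + |x.2| := by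
  set ζ : ℂ := ⟨x.1, x.2⟩ with hζ
  have h0 : ζ ≠ 0 := fun h => hx (Prod.ext (congrArg Complex.re h) (congrArg Complex.im h))
  refine ⟨(log ‖ζ‖, ζ.arg), ?_, ?_⟩
  · rw [logPolar, exp_log (norm_pos_iff.2 h0), Complex.norm_mul_cos_arg, Complex.norm_mul_sin_arg]
  · rw [exp_log (norm_pos_iff.2 h0)]
    exact Complex.norm_le_abs_re_add_abs_im ζ

variable {f : ℝ × ℝ → ℝ} {z : ℝ × ℝ}

lemma fderiv_logPolar_fst (z : ℝ × ℝ) :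
    fderiv ℝ logPolar z (1, 0) = logPolar z := by
  have h := (hasStrictFDerivAt_fst (𝕜 := ℝ) (p := z)).hasFDerivAt.exp.mul
    (hasStrictFDerivAt_snd (𝕜 := ℝ) (p := z)).hasFDerivAt.cos
  have h' := (hasStrictFDerivAt_fst (𝕜 := ℝ) (p := z)).hasFDerivAt.exp.mul
    (hasStrictFDerivAt_snd (𝕜 := ℝ) (p := z)).hasFDerivAt.sin
  have := (h.prodMk h').fderiv
  change fderiv ℝ logPolar z = _ at this
  rw [this]
  simp [logPolar, mul_comm]

lemma fderiv_logPolar_snd (z : ℝ × ℝ) :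
    fderiv ℝ logPolar z (0, 1) = (-(logPolar z).2, (logPolar z).1) := by
  have h := (hasStrictFDerivAt_fst (𝕜 := ℝ) (p := z)).hasFDerivAt.exp.mul
    (hasStrictFDerivAt_snd (𝕜 := ℝ) (p := z)).hasFDerivAt.cos
  have h' := (hasStrictFDerivAt_fst (𝕜 := ℝ) (p := z)).hasFDerivAt.exp.mul
    (hasStrictFDerivAt_snd (𝕜 := ℝ) (p := z)).hasFDerivAt.sin
  have := (h.prodMk h').fderiv
  change fderiv ℝ logPolar z = _ at this
  rw [this]
  simp [logPolar]

lemma pd1_comp_logPolar (hf : DifferentiableAt ℝ f (logPolar z)) :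
    pd1 (fun z => f (logPolar z)) z
      = (logPolar z).1 * pd1 f (logPolar z) + (logPolar z).2 * pd2 f (logPolar z) := by
  rw [pd1, fderiv_fun_comp z hf (contDiff_logPolar.differentiable one_ne_zero z),
    ContinuousLinearMap.comp_apply, fderiv_logPolar_fst, fderiv_apply_eq_pd]

lemma pd2_comp_logPolar (hf : DifferentiableAt ℝ f (logPolar z)) :
    pd2 (fun z => f (logPolar z)) z
      = -(logPolar z).2 * pd1 f (logPolar z) + (logPolar z).1 * pd2 f (logPolar z) := by
  rw [pd2, fderiv_fun_comp z hf (contDiff_logPolar.differentiable one_ne_zero z),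
    ContinuousLinearMap.comp_apply, fderiv_logPolar_snd, fderiv_apply_eq_pd]

lemma pd_logPolar (z : ℝ × ℝ) :
    pd1 (fun z => (logPolar z).1) z = (logPolar z).1 ∧ pd1 (fun z => (logPolar z).2) z = (logPolar z).2 ∧
    pd2 (fun z => (logPolar z).1) z = -(logPolar z).2 ∧
    pd2 (fun z => (logPolar z).2) z = (logPolar z).1 := by
  have h1 : pd1 Prod.fst (logPolar z) = 1 := by simp [pd1, fderiv_fst]
  have h2 : pd2 Prod.fst (logPolar z) = 0 := by simp [pd2, fderiv_fst]
  have h3 : pd1 Prod.snd (logPolar z) = 0 := by simp [pd1, fderiv_snd]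
  have h4 : pd2 Prod.snd (logPolar z) = 1 := by simp [pd2, fderiv_snd]
  refine ⟨?_, ?_, ?_, ?_⟩
  · rw [pd1_comp_logPolar (f := Prod.fst) differentiableAt_fst, h1, h2]
    ring
  · rw [pd1_comp_logPolar (f := Prod.snd) differentiableAt_snd, h3, h4]
    ring
  · rw [pd2_comp_logPolar (f := Prod.fst) differentiableAt_fst, h1, h2]
    ring
  · rw [pd2_comp_logPolar (f := Prod.snd) differentiableAt_snd, h3, h4]
    ring

lemma abs_logPolar_fst_le (z : ℝ × ℝ) : |(logPolar z).1| ≤ exp z.1 :=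
  (norm_fst_le (logPolar z)).trans (norm_logPolar_le z)

lemma abs_logPolar_snd_le (z : ℝ × ℝ) : |(logPolar z).2| ≤ exp z.1 :=
  (norm_snd_le (logPolar z)).trans (norm_logPolar_le z)

lemma abs_pd_comp_logPolar_le {B : ℝ} (hf : DifferentiableAt ℝ f (logPolar z))
    (h1 : |pd1 f (logPolar z)| ≤ B) (h2 : |pd2 f (logPolar z)| ≤ B) :
    |pd1 (fun z => f (logPolar z)) z| ≤ 2 * (B * exp z.1) ∧
    |pd2 (fun z => f (logPolar z)) z| ≤ 2 * (B * exp z.1) := by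
  have e1 := abs_logPolar_fst_le z
  have e2 := abs_logPolar_snd_le z
  rw [pd1_comp_logPolar hf, pd2_comp_logPolar hf]
  constructor
  · have := abs_mul_le_mul e1 h1
    have := abs_mul_le_mul e2 h2
    exact (abs_add_le _ _).trans (by linarith)
  · have := abs_mul_le_mul ((abs_neg _).trans_le e2) h1
    have := abs_mul_le_mul e1 h2
    exact (abs_add_le _ _).trans (by linarith)

/-- The trigonometric polynomial `p + q cos 2θ + r sin 2θ`, as a function of `(t, θ)`. -/
noncomputable def trig (p q r : ℝ) (z : ℝ × ℝ) : ℝ := p + q * cos (2 * z.2) + r * sin (2 * z.2)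

lemma contDiff_trig (p q r : ℝ) {n : WithTop ℕ∞} : ContDiff ℝ n (trig p q r) := by
  unfold trig
  fun_prop

lemma trig_add_period (p q r : ℝ) (z : ℝ × ℝ) : trig p q r (z + (0, 2 * π)) = trig p q r z := by
  have : 2 * (z + (0, 2 * π)).2 = 2 * z.2 + 2 * π + 2 * π := by
    simp only [Prod.snd_add]
    ring
  simp only [trig, this, cos_add_two_pi, sin_add_two_pi]

lemma pd1_trig (p q r : ℝ) (z : ℝ × ℝ) : pd1 (trig p q r) z = 0 := by
  have h := (hasStrictFDerivAt_snd (𝕜 := ℝ) (p := z)).hasFDerivAt.const_mul 2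
  have := (((hasFDerivAt_const p z).add (h.cos.const_mul q)).add (h.sin.const_mul r)).fderiv
  change fderiv ℝ (trig p q r) z = _ at this
  rw [pd1, this]
  simp

lemma pd2_trig (p q r : ℝ) (z : ℝ × ℝ) :
    pd2 (trig p q r) z = 2 * trig 0 r (-q) z := by
  have h := (hasStrictFDerivAt_snd (𝕜 := ℝ) (p := z)).hasFDerivAt.const_mul 2
  have := (((hasFDerivAt_const p z).add (h.cos.const_mul q)).add (h.sin.const_mul r)).fderiv
  change fderiv ℝ (trig p q r) z = _ at this
  rw [pd2, this]
  simp [trig]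
  ring

lemma abs_trig_le (p q r : ℝ) (z : ℝ × ℝ) : |trig p q r z| ≤ |p| + |q| + |r| := by
  have h1 := abs_mul_le_mul (le_refl |q|) (abs_cos_le_one (2 * z.2))
  have h2 := abs_mul_le_mul (le_refl |r|) (abs_sin_le_one (2 * z.2))
  exact (abs_add_three _ _ _).trans (by linarith)

lemma trig_mul_comp_logPolar_bounds {B p q r : ℝ} (hpqr : |p| + |q| + |r| ≤ 1)
    (hf : DifferentiableAt ℝ f (logPolar z)) (h : |f (logPolar z)| ≤ 2 * B * ‖logPolar z‖)
    (h1 : |pd1 f (logPolar z)| ≤ B) (h2 : |pd2 f (logPolar z)| ≤ B) :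
    |trig p q r z * f (logPolar z)| ≤ 2 * (B * exp z.1) ∧
    |pd1 (fun z => trig p q r z * f (logPolar z)) z| ≤ 2 * (B * exp z.1) ∧
    |pd2 (fun z => trig p q r z * f (logPolar z)) z| ≤ 6 * (B * exp z.1) := by
  have hB : 0 ≤ B := (abs_nonneg _).trans h1
  have dT : DifferentiableAt ℝ (trig p q r) z := (contDiff_trig p q r).differentiable one_ne_zero z
  have dP : DifferentiableAt ℝ (fun z => f (logPolar z)) z :=
    hf.comp z (contDiff_logPolar.differentiable one_ne_zero z)
  have hf' : |f (logPolar z)| ≤ 2 * (B * exp z.1) := by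
    have := mul_le_mul_of_nonneg_left (norm_logPolar_le z) hB
    linarith
  have hT := (abs_trig_le p q r z).trans hpqr
  have hT' : |2 * trig 0 r (-q) z| ≤ 2 := by
    have := abs_trig_le 0 r (-q) z
    rw [abs_neg, abs_zero] at this
    rw [abs_mul, abs_two]
    linarith [abs_nonneg p]
  obtain ⟨h3, h4⟩ := abs_pd_comp_logPolar_le hf h1 h2
  rw [pd1_mul dT dP, pd2_mul dT dP, pd1_trig, pd2_trig, zero_mul, zero_add]
  refine ⟨(abs_mul_le_mul hT hf').trans (by linarith), (abs_mul_le_mul hT h3).trans (by linarith),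
    (abs_add_le _ _).trans ?_⟩
  have := abs_mul_le_mul hT' hf'
  have := abs_mul_le_mul hT h4
  linarith

end PolarCoordinates

section StrongUniqueContinuation

variable {D : Set (ℝ × ℝ)} {f w a b c : ℝ × ℝ → ℝ} {B R T₀ : ℝ}

/-- Bounds on `f` and its first derivatives at the image points of `strip T₀`. -/
def PolarBound (T₀ B : ℝ) (f : ℝ × ℝ → ℝ) : Prop :=
  ∀ z ∈ strip T₀, ContDiffAt ℝ (⊤ : ℕ∞) f (logPolar z) ∧
    |f (logPolar z)| ≤ 2 * B * ‖logPolar z‖ ∧ |pd1 f (logPolar z)| ≤ B ∧ |pd2 f (logPolar z)| ≤ B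

lemma polarBound_combination {q₁ q₂ q₃ : ℝ × ℝ → ℝ} {k l₁ m₁ n₁ l₂ m₂ n₂ l₃ m₃ n₃ : ℝ}
    (h₁ : PolarBound T₀ B q₁) (h₂ : PolarBound T₀ B q₂) (h₃ : PolarBound T₀ B q₃)
    (k₁ : |l₁| + |m₁| + |n₁| ≤ 1) (k₂ : |l₂| + |m₂| + |n₂| ≤ 1) (k₃ : |l₃| + |m₃| + |n₃| ≤ 1)
    (hT : 24 * (B * exp T₀) ≤ 1) {α : ℝ × ℝ → ℝ}
    (hα : α = fun z => k + (trig l₁ m₁ n₁ z * q₁ (logPolar z) + trig l₂ m₂ n₂ z * q₂ (logPolar z)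
      + trig l₃ m₃ n₃ z * q₃ (logPolar z))) :
    ContDiffOn ℝ (⊤ : ℕ∞) α (strip T₀) ∧ (∀ z, α (z + (0, 2 * π)) = α z) ∧
    (∀ z ∈ strip T₀, |α z - k| ≤ 1 / 4) ∧
    (∀ z ∈ strip T₀, |pd1 α z| ≤ 18 * B * exp z.1) ∧
    (∀ z ∈ strip T₀, |pd2 α z| ≤ 18 * B * exp z.1) := by
  have s {q : ℝ × ℝ → ℝ} {l m n : ℝ} (hq : PolarBound T₀ B q) {z : ℝ × ℝ} (hz : z ∈ strip T₀) :
      ContDiffAt ℝ (⊤ : ℕ∞) (fun z => trig l m n z * q (logPolar z)) z :=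
    (contDiff_trig l m n).contDiffAt.mul ((hq z hz).1.comp z contDiff_logPolar.contDiffAt)
  have d {q : ℝ × ℝ → ℝ} {l m n : ℝ} (hq : PolarBound T₀ B q) {z : ℝ × ℝ} (hz : z ∈ strip T₀) :
      DifferentiableAt ℝ (fun z => trig l m n z * q (logPolar z)) z :=
    (s hq hz).differentiableAt (by simp)
  have bd {q : ℝ × ℝ → ℝ} {l m n : ℝ} (hq : PolarBound T₀ B q) (hk : |l| + |m| + |n| ≤ 1)
      {z : ℝ × ℝ} (hz : z ∈ strip T₀) :=
    trig_mul_comp_logPolar_bounds hk ((hq z hz).1.differentiableAt (by simp)) (hq z hz).2.1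
      (hq z hz).2.2.1 (hq z hz).2.2.2
  have pos {z : ℝ × ℝ} (hz : z ∈ strip T₀) : 0 ≤ B * exp z.1 :=
    mul_nonneg ((abs_nonneg _).trans (h₁ z hz).2.2.1) (exp_pos _).le
  subst hα
  refine ⟨fun z hz => ?_, fun z => ?_, fun z hz => ?_, fun z hz => ?_, fun z hz => ?_⟩
  · exact (contDiffAt_const.add (((s h₁ hz).add (s h₂ hz)).add (s h₃ hz))).contDiffWithinAt
  · simp only [trig_add_period, logPolar_add_period]
  · have hle : B * exp z.1 ≤ B * exp T₀ :=
      mul_le_mul_of_nonneg_left (exp_le_exp.2 (le_of_lt hz)) ((abs_nonneg _).trans (h₁ z hz).2.2.1)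
    rw [add_sub_cancel_left]
    have := (bd h₁ k₁ hz).1
    have := (bd h₂ k₂ hz).1
    have := (bd h₃ k₃ hz).1
    exact (abs_add_three _ _ _).trans (by linarith)
  · have := (bd h₁ k₁ hz).2.1
    have := (bd h₂ k₂ hz).2.1
    have := (bd h₃ k₃ hz).2.1
    rw [pd1_add (differentiableAt_const k) (((d h₁ hz).fun_add (d h₂ hz)).fun_add (d h₃ hz)),
      pd1_add ((d h₁ hz).fun_add (d h₂ hz)) (d h₃ hz), pd1_add (d h₁ hz) (d h₂ hz), pd1_const,
      zero_add]
    have := pos hz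
    exact (abs_add_three _ _ _).trans (by linarith)
  · have := (bd h₁ k₁ hz).2.2
    have := (bd h₂ k₂ hz).2.2
    have := (bd h₃ k₃ hz).2.2
    rw [pd2_add (differentiableAt_const k) (((d h₁ hz).fun_add (d h₂ hz)).fun_add (d h₃ hz)),
      pd2_add ((d h₁ hz).fun_add (d h₂ hz)) (d h₃ hz), pd2_add (d h₁ hz) (d h₂ hz), pd2_const,
      zero_add]
    exact (abs_add_three _ _ _).trans (by linarith)

lemma exists_C1_bound (hD : IsOpen D) (sf : ContDiffOn ℝ (⊤ : ℕ∞) f D)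
    (hR : Metric.closedBall 0 R ⊆ D) :
    ∃ B, 0 ≤ B ∧ ∀ x ∈ Metric.closedBall (0 : ℝ × ℝ) R, |f x| ≤ B ∧ |pd1 f x| ≤ B ∧ |pd2 f x| ≤ B := by
  have hc : ContinuousOn (fun x => (f x, pd1 f x, pd2 f x)) (Metric.closedBall 0 R) :=
    (sf.continuousOn.prodMk ((sf.pd1 hD).continuousOn.prodMk (sf.pd2 hD).continuousOn)).mono hR
  obtain ⟨B, hB⟩ := (isCompact_closedBall (0 : ℝ × ℝ) R).exists_bound_of_continuousOn hc
  refine ⟨|B|, abs_nonneg B, fun x hx => ?_⟩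
  have := (hB x hx).trans (le_abs_self B)
  simpa only [Prod.norm_def, max_le_iff, Real.norm_eq_abs] using this

lemma abs_le_of_pd_bound (hD : IsOpen D) (sf : ContDiffOn ℝ (⊤ : ℕ∞) f D)
    (hR : Metric.closedBall 0 R ⊆ D) (h0 : f 0 = 0)
    (hB : ∀ x ∈ Metric.closedBall (0 : ℝ × ℝ) R, |pd1 f x| ≤ B ∧ |pd2 f x| ≤ B) {x : ℝ × ℝ}
    (hx : x ∈ Metric.closedBall (0 : ℝ × ℝ) R) : |f x| ≤ 2 * B * ‖x‖ := by
  have hR0 : 0 ≤ R := (norm_nonneg x).trans (by simpa using hx)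
  have := (convex_closedBall (0 : ℝ × ℝ) R).norm_image_sub_le_of_norm_fderiv_le (𝕜 := ℝ) (f := f)
    (C := 2 * B) (fun y hy => sf.differentiableAt_of_isOpen hD (hR hy))
    (fun y hy => (norm_fderiv_le_pd f y).trans (by linarith [(hB y hy).1, (hB y hy).2]))
    (Metric.mem_closedBall_self hR0) hx
  simpa [h0] using this

/-- A bounded function which is `o(‖x‖ ^ N)` at the origin is bounded by a multiple of `‖x‖ ^ N`. -/
lemma exists_abs_le_mul_norm_pow {N : ℕ} (ho : w =o[nhds 0] fun x : ℝ × ℝ => ‖x‖ ^ N) {s : Set (ℝ × ℝ)}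
    (hw : ∀ x ∈ s, |w x| ≤ B) : ∃ K, 0 ≤ K ∧ ∀ x ∈ s, |w x| ≤ K * ‖x‖ ^ N := by
  obtain ⟨ρ, hρ, hball⟩ := Metric.eventually_nhds_iff_ball.1 (ho.bound one_pos)
  refine ⟨1 + |B| / ρ ^ N, by positivity, fun x hx => ?_⟩
  by_cases hxρ : x ∈ Metric.ball 0 ρ
  · have := hball x hxρ
    rw [Real.norm_eq_abs, norm_pow, norm_norm] at this
    refine this.trans (mul_le_mul_of_nonneg_right ?_ (by positivity))
    have : 0 ≤ |B| / ρ ^ N := by positivity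
    linarith
  · have h1 : ρ ≤ ‖x‖ := by simpa using hxρ
    have h2 : ρ ^ N ≤ ‖x‖ ^ N := pow_le_pow_left₀ hρ.le h1 N
    calc |w x| ≤ |B| := (hw x hx).trans (le_abs_self B)
      _ = |B| / ρ ^ N * ρ ^ N := by field_simp
      _ ≤ (1 + |B| / ρ ^ N) * ‖x‖ ^ N := by gcongr; linarith

/-- The divergence of a vector field in logarithmic polar coordinates. -/
lemma divergence_logPolar {F G : ℝ × ℝ → ℝ} {z : ℝ × ℝ} (hF : DifferentiableAt ℝ F (logPolar z))
    (hG : DifferentiableAt ℝ G (logPolar z)) :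
    pd1 (fun z => (logPolar z).1 * F (logPolar z) + (logPolar z).2 * G (logPolar z)) z
      + pd2 (fun z => (logPolar z).1 * G (logPolar z) - (logPolar z).2 * F (logPolar z)) z
      = ((logPolar z).1 ^ 2 + (logPolar z).2 ^ 2) * (pd1 F (logPolar z) + pd2 G (logPolar z)) := by
  have dp : DifferentiableAt ℝ logPolar z := contDiff_logPolar.differentiable one_ne_zero z
  have dF : DifferentiableAt ℝ (fun z => F (logPolar z)) z := hF.comp z dp
  have dG : DifferentiableAt ℝ (fun z => G (logPolar z)) z := hG.comp z dp
  obtain ⟨h1, h2, h3, h4⟩ := pd_logPolar z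
  rw [pd1_add (dp.fst.fun_mul dF) (dp.snd.fun_mul dG), pd2_sub (dp.fst.fun_mul dG) (dp.snd.fun_mul dF),
    pd1_mul dp.fst dF, pd1_mul dp.snd dG, pd2_mul dp.fst dG, pd2_mul dp.snd dF, h1, h2, h3, h4,
    pd1_comp_logPolar hF, pd1_comp_logPolar hG, pd2_comp_logPolar hF, pd2_comp_logPolar hG]
  ring

/-- Strong unique continuation: a solution of `∂₁(a w₁ + b w₂) + ∂₂(b w₁ + c w₂) = 0`, with smooth
coefficients which agree with those of the Laplacian at the origin, vanishes near the origin if all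
its derivatives vanish there. -/
lemma eventuallyEq_zero_of_flat (hD : IsOpen D) (h0 : (0 : ℝ × ℝ) ∈ D)
    (sw : ContDiffOn ℝ (⊤ : ℕ∞) w D) (sa : ContDiffOn ℝ (⊤ : ℕ∞) a D)
    (sb : ContDiffOn ℝ (⊤ : ℕ∞) b D) (sc : ContDiffOn ℝ (⊤ : ℕ∞) c D)
    (ha : a 0 = 1) (hb : b 0 = 0) (hc : c 0 = 1)
    (hpde : ∀ x ∈ D, pd1 (fun x => a x * pd1 w x + b x * pd2 w x) x
      + pd2 (fun x => b x * pd1 w x + c x * pd2 w x) x = 0)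
    (hflat : ∀ N, Flat N w) : w =ᶠ[nhds 0] 0 := by
  obtain ⟨R, hR, hRD⟩ := Metric.nhds_basis_closedBall.mem_iff.1 (hD.mem_nhds h0)
  have sa' : ContDiffOn ℝ (⊤ : ℕ∞) (fun x => a x - 1) D := sa.sub contDiffOn_const
  have sc' : ContDiffOn ℝ (⊤ : ℕ∞) (fun x => c x - 1) D := sc.sub contDiffOn_const
  obtain ⟨B₁, p₁, hB₁⟩ := exists_C1_bound hD sw hRD
  obtain ⟨B₂, p₂, hB₂⟩ := exists_C1_bound hD sa' hRD
  obtain ⟨B₃, p₃, hB₃⟩ := exists_C1_bound hD sb hRD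
  obtain ⟨B₄, p₄, hB₄⟩ := exists_C1_bound hD sc' hRD
  set B := B₁ + B₂ + B₃ + B₄ with hB
  have Bpos : 0 ≤ B := by positivity
  set r := min R (1 / (24 * (B + 1))) with hr
  have rpos : 0 < r := lt_min hR (by positivity)
  set T₀ := log r with hT₀
  have hexp : exp T₀ = r := exp_log rpos
  have hT : 24 * (B * exp T₀) ≤ 1 := by
    have h1 : r ≤ 1 / (24 * (B + 1)) := min_le_right _ _
    rw [le_div_iff₀ (by positivity)] at h1
    rw [hexp]
    linarith
  have memR {z : ℝ × ℝ} (hz : z ∈ strip T₀) : logPolar z ∈ Metric.closedBall (0 : ℝ × ℝ) R := by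
    have h1 : exp z.1 ≤ r := hexp ▸ exp_le_exp.2 (le_of_lt hz)
    simpa using (norm_logPolar_le z).trans (h1.trans (min_le_left _ _))
  have memD {z : ℝ × ℝ} (hz : z ∈ strip T₀) := hRD (memR hz)
  have bound {q : ℝ × ℝ → ℝ} {B' : ℝ} (sq : ContDiffOn ℝ (⊤ : ℕ∞) q D) (hq : q 0 = 0)
      (hB' : ∀ x ∈ Metric.closedBall (0 : ℝ × ℝ) R, |q x| ≤ B' ∧ |pd1 q x| ≤ B' ∧ |pd2 q x| ≤ B')
      (hle : B' ≤ B) : PolarBound T₀ B q := fun z hz =>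
    ⟨sq.contDiffAt (hD.mem_nhds (memD hz)),
      abs_le_of_pd_bound hD sq hRD hq (fun x hx => ⟨(hB' x hx).2.1.trans hle, (hB' x hx).2.2.trans hle⟩)
        (memR hz), (hB' _ (memR hz)).2.1.trans hle, (hB' _ (memR hz)).2.2.trans hle⟩
  have ba := bound sa' (by simp [ha]) hB₂ (by linarith)
  have bb := bound sb hb hB₃ (by linarith)
  have bc := bound sc' (by simp [hc]) hB₄ (by linarith)
  obtain ⟨sα, pα, hα, hα₁, hα₂⟩ := polarBound_combination (k := 1) (l₁ := 1 / 2) (m₁ := 1 / 2) (n₁ := 0)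
    (l₂ := 0) (m₂ := 0) (n₂ := 1) (l₃ := 1 / 2) (m₃ := -(1 / 2)) (n₃ := 0) ba bb bc
    (by norm_num [abs_div]) (by norm_num) (by norm_num [abs_div]) hT rfl
  obtain ⟨sβ, pβ, hβ, hβ₁, hβ₂⟩ := polarBound_combination (k := 0) (l₁ := 0) (m₁ := 0)
    (n₁ := -(1 / 2)) (l₂ := 0) (m₂ := 1) (n₂ := 0) (l₃ := 0) (m₃ := 0) (n₃ := 1 / 2) ba bb bc
    (by norm_num [abs_div]) (by norm_num) (by norm_num [abs_div]) hT rfl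
  obtain ⟨sγ, pγ, hγ, hγ₁, hγ₂⟩ := polarBound_combination (k := 1) (l₁ := 1 / 2) (m₁ := -(1 / 2))
    (n₁ := 0) (l₂ := 0) (m₂ := 0) (n₂ := -1) (l₃ := 1 / 2) (m₃ := 1 / 2) (n₃ := 0) ba bb bc
    (by norm_num [abs_div]) (by norm_num) (by norm_num [abs_div]) hT rfl
  have dw {z : ℝ × ℝ} (hz : z ∈ strip T₀) := sw.differentiableAt_of_isOpen hD (memD hz)
  have wbd {z : ℝ × ℝ} (hz : z ∈ strip T₀) := abs_pd_comp_logPolar_le (B := B) (dw hz)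
    ((hB₁ _ (memR hz)).2.1.trans (by linarith)) ((hB₁ _ (memR hz)).2.2.trans (by linarith))
  have zero := eq_zero_on_strip (M := 18 * B) (W := fun z => w (logPolar z))
    (sw.comp contDiff_logPolar.contDiffOn fun z hz => memD hz) sα sβ sγ
    (fun z => by simp only [logPolar_add_period]) pα pβ pγ hα
    (fun z hz => by simpa only [sub_zero] using hβ z hz) hγ hα₁ hα₂ hβ₁ hβ₂ hγ₁ hγ₂
    (fun z hz => (hB₁ _ (memR hz)).1.trans (by linarith))
    (fun z hz => (wbd hz).1.trans (by nlinarith [exp_pos z.1]))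
    (fun z hz => (wbd hz).2.trans (by nlinarith [exp_pos z.1])) (fun N => ?_) (fun z hz => ?_)
  · filter_upwards [Metric.ball_mem_nhds (0 : ℝ × ℝ) (half_pos rpos)] with x hx
    rcases eq_or_ne x 0 with rfl | hx0
    · exact (hflat 1).1
    · obtain ⟨z, rfl, hz⟩ := exists_logPolar_eq hx0
      refine zero z ?_
      have hn : ‖logPolar z‖ < r / 2 := by simpa using hx
      have h1 := norm_fst_le (logPolar z)
      have h2 := norm_snd_le (logPolar z)
      rw [Real.norm_eq_abs] at h1 h2
      exact exp_lt_exp.1 (by linarith)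
  · obtain ⟨K, hK0, hK⟩ := exists_abs_le_mul_norm_pow ((hflat (N + 1)).isLittleO hD h0 sw)
      (fun x hx => (hB₁ x hx).1)
    refine ⟨K * B₁, fun z hz => ?_⟩
    have h1 : |w (logPolar z)| ≤ K * exp (N * z.1) := by
      refine (hK _ (memR hz)).trans (mul_le_mul_of_nonneg_left ?_ hK0)
      rw [exp_nat_mul]
      exact pow_le_pow_left₀ (norm_nonneg _) (norm_logPolar_le z) N
    have h2 := abs_mul_le_mul h1 (hB₁ _ (memR hz)).1
    have h3 := (le_abs_self _).trans h2
    linarith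
  · set X₁ : ℝ × ℝ → ℝ := fun x => a x * pd1 w x + b x * pd2 w x with hX₁
    set X₂ : ℝ × ℝ → ℝ := fun x => b x * pd1 w x + c x * pd2 w x with hX₂
    have sX₁ : ContDiffOn ℝ (⊤ : ℕ∞) X₁ D := (sa.mul (sw.pd1 hD)).add (sb.mul (sw.pd2 hD))
    have sX₂ : ContDiffOn ℝ (⊤ : ℕ∞) X₂ D := (sb.mul (sw.pd1 hD)).add (sc.mul (sw.pd2 hD))
    have hdiv := divergence_logPolar (sX₁.differentiableAt_of_isOpen hD (memD hz))
      (sX₂.differentiableAt_of_isOpen hD (memD hz))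
    rw [hpde _ (memD hz), mul_zero] at hdiv
    refine Eq.trans (congrArg₂ (· + ·) ?_ ?_) hdiv
    · refine pd1_congr ?_
      filter_upwards [isOpen_strip.mem_nhds hz] with y hy
      rw [pd1_comp_logPolar (dw hy), pd2_comp_logPolar (dw hy)]
      simp only [trig, cos_two_mul', sin_two_mul]
      have hp1 : (logPolar y).1 = exp y.1 * cos y.2 := rfl
      have hp2 : (logPolar y).2 = exp y.1 * sin y.2 := rfl
      rw [hp1, hp2]
      simp only [hX₁, hX₂]
      linear_combination exp y.1 * (cos y.2
          * (a (logPolar y) * pd1 w (logPolar y) + b (logPolar y) * pd2 w (logPolar y)) + sin y.2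
          * (b (logPolar y) * pd1 w (logPolar y) + c (logPolar y) * pd2 w (logPolar y))
        - (a (logPolar y) + c (logPolar y)) / 2
          * (cos y.2 * pd1 w (logPolar y) + sin y.2 * pd2 w (logPolar y))) * sin_sq_add_cos_sq y.2
    · refine pd2_congr ?_
      filter_upwards [isOpen_strip.mem_nhds hz] with y hy
      rw [pd1_comp_logPolar (dw hy), pd2_comp_logPolar (dw hy)]
      simp only [trig, cos_two_mul', sin_two_mul]
      have hp1 : (logPolar y).1 = exp y.1 * cos y.2 := rfl
      have hp2 : (logPolar y).2 = exp y.1 * sin y.2 := rfl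
      rw [hp1, hp2]
      simp only [hX₁, hX₂]
      linear_combination exp y.1 * (cos y.2
          * (b (logPolar y) * pd1 w (logPolar y) + c (logPolar y) * pd2 w (logPolar y)) - sin y.2
          * (a (logPolar y) * pd1 w (logPolar y) + b (logPolar y) * pd2 w (logPolar y))
        - (a (logPolar y) + c (logPolar y)) / 2
          * (cos y.2 * pd2 w (logPolar y) - sin y.2 * pd1 w (logPolar y))) * sin_sq_add_cos_sq y.2

end StrongUniqueContinuation

section NormalForm

variable {D : Set (ℝ × ℝ)} {f w a b c : ℝ × ℝ → ℝ}

/-- Leading term at a degenerate zero of a solution of `∂₁(a w₁ + b w₂) + ∂₂(b w₁ + c w₂) = 0`, when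
the coefficients agree with those of the Laplacian at the origin. -/
lemma exists_leading_term_of_divergence (hD : IsOpen D) (h0 : (0 : ℝ × ℝ) ∈ D)
    (sw : ContDiffOn ℝ (⊤ : ℕ∞) w D) (sa : ContDiffOn ℝ (⊤ : ℕ∞) a D)
    (sb : ContDiffOn ℝ (⊤ : ℕ∞) b D) (sc : ContDiffOn ℝ (⊤ : ℕ∞) c D)
    (ha : a 0 = 1) (hb : b 0 = 0) (hc : c 0 = 1)
    (hpde : ∀ x ∈ D, pd1 (fun x => a x * pd1 w x + b x * pd2 w x) x
      + pd2 (fun x => b x * pd1 w x + c x * pd2 w x) x = 0)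
    (hflat : Flat 3 w) (hnz : ¬ w =ᶠ[nhds 0] 0) :
    ∃ (n : ℕ) (μ : ℂ), 3 ≤ n ∧ μ ≠ 0 ∧
      (fun x : ℝ × ℝ => w x - (μ * ((x.1 : ℂ) + (x.2 : ℂ) * Complex.I) ^ n).re)
        =o[nhds 0] fun x : ℝ × ℝ => ‖x‖ ^ n := by
  classical
  have hex : ∃ N, ¬ Flat N w := by
    by_contra! h
    exact hnz (eventuallyEq_zero_of_flat hD h0 sw sa sb sc ha hb hc hpde h)
  have hN := Nat.find_spec hex
  have hmin : ∀ m < Nat.find hex, Flat m w := fun m hm => not_not.1 (Nat.find_min hex hm)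
  have h4 : 4 ≤ Nat.find hex := by
    by_contra! h
    exact hN (hflat.mono (by omega))
  obtain ⟨p, hp⟩ := Nat.exists_eq_add_of_le' h4
  rw [hp] at hN hmin
  have hw : Flat (p + 3) w := hmin _ (by omega)
  have s1 := sw.pd1 hD
  have s2 := sw.pd2 hD
  have flat_one {g : ℝ × ℝ → ℝ} (hg : g 0 = 0) : Flat 1 g := ⟨hg, trivial, trivial⟩
  have top {q g : ℝ × ℝ → ℝ} (sq : ContDiffOn ℝ (⊤ : ℕ∞) q D) (sg : ContDiffOn ℝ (⊤ : ℕ∞) g D)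
      (hq : q 0 = 0) (hg : Flat (p + 1) g) : Flat (p + 2) fun x => q x * g x :=
    ((flat_one hq).mul hD h0 sq sg hg).mono (by omega)
  have low {q g : ℝ × ℝ → ℝ} (sq : ContDiffOn ℝ (⊤ : ℕ∞) q D) (sg : ContDiffOn ℝ (⊤ : ℕ∞) g D)
      (hg : Flat (p + 2) g) : Flat (p + 2) fun x => q x * g x :=
    (Flat.mul hD h0 (j := 0) sq sg trivial hg).mono (by omega)
  have sa' : ContDiffOn ℝ (⊤ : ℕ∞) (fun x => 1 - a x) D := contDiffOn_const.sub sa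
  have sb' : ContDiffOn ℝ (⊤ : ℕ∞) (fun x => -2 * b x) D := contDiffOn_const.mul sb
  have sc' : ContDiffOn ℝ (⊤ : ℕ∞) (fun x => 1 - c x) D := contDiffOn_const.sub sc
  have sd : ContDiffOn ℝ (⊤ : ℕ∞) (fun x => -pd1 a x - pd2 b x) D := (sa.pd1 hD).neg.sub (sb.pd2 hD)
  have se : ContDiffOn ℝ (⊤ : ℕ∞) (fun x => -pd1 b x - pd2 c x) D := (sb.pd1 hD).neg.sub (sc.pd2 hD)
  have f1 := top sa' (s1.pd1 hD) (by simp [ha]) hw.2.1.2.1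
  have f2 := top sb' (s2.pd1 hD) (by simp [hb]) hw.2.2.2.1
  have f3 := top sc' (s2.pd2 hD) (by simp [hc]) hw.2.2.2.2
  have f4 := low sd s1 hw.2.1
  have f5 := low se s2 hw.2.2
  have hsum := f1.add hD h0 (sa'.mul (s1.pd1 hD)) ((sb'.mul (s2.pd1 hD)).add ((sc'.mul (s2.pd2 hD)).add
    ((sd.mul s1).add (se.mul s2)))) (f2.add hD h0 (sb'.mul (s2.pd1 hD)) ((sc'.mul (s2.pd2 hD)).add
    ((sd.mul s1).add (se.mul s2))) (f3.add hD h0 (sc'.mul (s2.pd2 hD)) ((sd.mul s1).add (se.mul s2))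
    (f4.add hD h0 (sd.mul s1) (se.mul s2) f5)))
  have hlap : Flat (p + 2) fun x => pd1 (pd1 w) x + pd2 (pd2 w) x := by
    refine hsum.congr ?_
    filter_upwards [hD.mem_nhds h0] with x hx
    have h := hpde x hx
    have da := sa.differentiableAt_of_isOpen hD hx
    have db := sb.differentiableAt_of_isOpen hD hx
    have dc := sc.differentiableAt_of_isOpen hD hx
    have d1 := s1.differentiableAt_of_isOpen hD hx
    have d2 := s2.differentiableAt_of_isOpen hD hx
    rw [pd1_add (da.fun_mul d1) (db.fun_mul d2), pd2_add (db.fun_mul d1) (dc.fun_mul d2),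
      pd1_mul da d1, pd1_mul db d2, pd2_mul db d1, pd2_mul dc d2, ← pd1_pd2_comm sw hD hx] at h
    linear_combination -h
  obtain ⟨μ, hμ, ho⟩ := exists_leading_term_of_laplacian hD h0 (p + 2) sw hw hN hlap
  exact ⟨p + 3, μ, by omega, hμ, ho⟩

/-- The linear map `(ξ, η) ↦ (l ξ, k ξ + m η)`. -/
noncomputable def lowerTriangular (l k m : ℝ) : ℝ × ℝ →L[ℝ] ℝ × ℝ :=
  (l • ContinuousLinearMap.fst ℝ ℝ ℝ).prod
    (k • ContinuousLinearMap.fst ℝ ℝ ℝ + m • ContinuousLinearMap.snd ℝ ℝ ℝ)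

variable {l k m : ℝ} {x : ℝ × ℝ}

lemma lowerTriangular_apply (l k m : ℝ) (x : ℝ × ℝ) :
    lowerTriangular l k m x = (l * x.1, k * x.1 + m * x.2) := by
  simp [lowerTriangular]

lemma pd1_comp_lowerTriangular (hf : DifferentiableAt ℝ f (lowerTriangular l k m x)) :
    pd1 (fun x => f (lowerTriangular l k m x)) x
      = l * pd1 f (lowerTriangular l k m x) + k * pd2 f (lowerTriangular l k m x) := by
  rw [pd1, fderiv_fun_comp x hf (lowerTriangular l k m).differentiableAt,
    ContinuousLinearMap.comp_apply, ContinuousLinearMap.fderiv, fderiv_apply_eq_pd]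
  simp [lowerTriangular_apply]

lemma pd2_comp_lowerTriangular (hf : DifferentiableAt ℝ f (lowerTriangular l k m x)) :
    pd2 (fun x => f (lowerTriangular l k m x)) x = m * pd2 f (lowerTriangular l k m x) := by
  rw [pd2, fderiv_fun_comp x hf (lowerTriangular l k m).differentiableAt,
    ContinuousLinearMap.comp_apply, ContinuousLinearMap.fderiv, fderiv_apply_eq_pd]
  simp [lowerTriangular_apply]

lemma ContDiffOn.comp_lowerTriangular (sf : ContDiffOn ℝ (⊤ : ℕ∞) f D) :
    ContDiffOn ℝ (⊤ : ℕ∞) (fun x => f (lowerTriangular l k m x)) (lowerTriangular l k m ⁻¹' D) :=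
  sf.comp (lowerTriangular l k m).contDiff.contDiffOn fun _ hx => hx

lemma Flat.comp_lowerTriangular {n : ℕ} (hD : IsOpen D) (h0 : (0 : ℝ × ℝ) ∈ D)
    (sf : ContDiffOn ℝ (⊤ : ℕ∞) f D) (hf : Flat n f) :
    Flat n fun x => f (lowerTriangular l k m x) := by
  have hD' : IsOpen (lowerTriangular l k m ⁻¹' D) := hD.preimage (lowerTriangular l k m).continuous
  have h0' : (0 : ℝ × ℝ) ∈ lowerTriangular l k m ⁻¹' D := by simpa using h0
  induction n generalizing f with
  | zero => trivial
  | succ n ih =>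
    have s1 := (sf.pd1 hD).comp_lowerTriangular (l := l) (k := k) (m := m)
    have s2 := (sf.pd2 hD).comp_lowerTriangular (l := l) (k := k) (m := m)
    have f1 := ih (sf.pd1 hD) hf.2.1
    have f2 := ih (sf.pd2 hD) hf.2.2
    refine ⟨by simpa using hf.1, ?_, ?_⟩
    · refine ((f1.const_mul hD' h0' s1 l).add hD' h0' (contDiffOn_const.mul s1)
        (contDiffOn_const.mul s2) (f2.const_mul hD' h0' s2 k)).congr ?_
      filter_upwards [hD'.mem_nhds h0'] with x hx
      exact (pd1_comp_lowerTriangular (sf.differentiableAt_of_isOpen hD hx)).symm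
    · refine (f2.const_mul hD' h0' s2 m).congr ?_
      filter_upwards [hD'.mem_nhds h0'] with x hx
      exact (pd2_comp_lowerTriangular (sf.differentiableAt_of_isOpen hD hx)).symm

/-- Transformation of a divergence form equation under a linear change of coordinates. -/
lemma divergence_comp_lowerTriangular (hD : IsOpen D) (sw : ContDiffOn ℝ (⊤ : ℕ∞) w D)
    (sa : ContDiffOn ℝ (⊤ : ℕ∞) a D) (sb : ContDiffOn ℝ (⊤ : ℕ∞) b D)
    (sc : ContDiffOn ℝ (⊤ : ℕ∞) c D)
    (hpde : ∀ x ∈ D, pd1 (fun x => a x * pd1 w x + b x * pd2 w x) x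
      + pd2 (fun x => b x * pd1 w x + c x * pd2 w x) x = 0)
    {L : ℝ × ℝ → ℝ × ℝ} (hL : L = lowerTriangular l k m) {W : ℝ × ℝ → ℝ} (hW : W = fun x => w (L x)) :
    ∀ x ∈ L ⁻¹' D,
      pd1 (fun x => m ^ 2 * a (L x) * pd1 W x + m * (l * b (L x) - k * a (L x)) * pd2 W x) x
      + pd2 (fun x => m * (l * b (L x) - k * a (L x)) * pd1 W x
        + (k ^ 2 * a (L x) - 2 * k * l * b (L x) + l ^ 2 * c (L x)) * pd2 W x) x = 0 := by
  subst hL hW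
  intro x hx
  have hD' : IsOpen (lowerTriangular l k m ⁻¹' D) := hD.preimage (lowerTriangular l k m).continuous
  set X₁ : ℝ × ℝ → ℝ := fun x => a x * pd1 w x + b x * pd2 w x with hX₁
  set X₂ : ℝ × ℝ → ℝ := fun x => b x * pd1 w x + c x * pd2 w x with hX₂
  have sX₁ : ContDiffOn ℝ (⊤ : ℕ∞) X₁ D := (sa.mul (sw.pd1 hD)).add (sb.mul (sw.pd2 hD))
  have sX₂ : ContDiffOn ℝ (⊤ : ℕ∞) X₂ D := (sb.mul (sw.pd1 hD)).add (sc.mul (sw.pd2 hD))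
  have dX₁ := sX₁.differentiableAt_of_isOpen hD hx
  have dX₂ := sX₂.differentiableAt_of_isOpen hD hx
  have dY₁ := sX₁.comp_lowerTriangular.differentiableAt_of_isOpen hD' hx
  have dY₂ := sX₂.comp_lowerTriangular.differentiableAt_of_isOpen hD' hx
  have h1 : pd1 (fun x => m ^ 2 * l * X₁ (lowerTriangular l k m x)) x
      + pd2 (fun x => m * l ^ 2 * X₂ (lowerTriangular l k m x)
        - m * l * k * X₁ (lowerTriangular l k m x)) x = 0 := by
    rw [pd2_sub ((differentiableAt_const _).fun_mul dY₂) ((differentiableAt_const _).fun_mul dY₁),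
      pd1_mul (differentiableAt_const _) dY₁, pd2_mul (differentiableAt_const _) dY₁,
      pd2_mul (differentiableAt_const _) dY₂, pd1_const, pd2_const, pd2_const,
      pd1_comp_lowerTriangular dX₁, pd2_comp_lowerTriangular dX₁, pd2_comp_lowerTriangular dX₂]
    linear_combination m ^ 2 * l ^ 2 * hpde _ hx
  refine Eq.trans (congrArg₂ (· + ·) (pd1_congr ?_) (pd2_congr ?_)) h1 <;>
  · filter_upwards [hD'.mem_nhds hx] with y hy
    have dw := sw.differentiableAt_of_isOpen hD hy
    rw [pd1_comp_lowerTriangular dw, pd2_comp_lowerTriangular dw]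
    simp only [hX₁, hX₂]
    ring

/-- Leading term at a degenerate zero of a solution of an elliptic equation
`∂₁(a w₁ + b w₂) + ∂₂(b w₁ + c w₂) = 0`. -/
lemma exists_leading_term_of_elliptic (hD : IsOpen D) (h0 : (0 : ℝ × ℝ) ∈ D)
    (sw : ContDiffOn ℝ (⊤ : ℕ∞) w D) (sa : ContDiffOn ℝ (⊤ : ℕ∞) a D)
    (sb : ContDiffOn ℝ (⊤ : ℕ∞) b D) (sc : ContDiffOn ℝ (⊤ : ℕ∞) c D)
    (ha : 0 < a 0) (hdet : 0 < a 0 * c 0 - b 0 ^ 2)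
    (hpde : ∀ x ∈ D, pd1 (fun x => a x * pd1 w x + b x * pd2 w x) x
      + pd2 (fun x => b x * pd1 w x + c x * pd2 w x) x = 0)
    (hflat : Flat 3 w) (hnz : ¬ w =ᶠ[nhds 0] 0) :
    ∃ (L : (ℝ × ℝ) ≃ₗ[ℝ] (ℝ × ℝ)) (n : ℕ) (μ : ℂ), 3 ≤ n ∧ μ ≠ 0 ∧
      (fun x : ℝ × ℝ => w x - (μ * (((L x).1 : ℂ) + ((L x).2 : ℂ) * Complex.I) ^ n).re)
        =o[nhds 0] fun x : ℝ × ℝ => ‖L x‖ ^ n := by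
  set m := (√(a 0))⁻¹ with hm
  set l := √(a 0 / (a 0 * c 0 - b 0 ^ 2)) with hl
  set k := l * b 0 / a 0 with hk
  have hm2 : m ^ 2 * a 0 = 1 := by
    rw [hm, inv_pow, sq_sqrt ha.le, inv_mul_cancel₀ ha.ne']
  have hl2 : l ^ 2 * (a 0 * c 0 - b 0 ^ 2) = a 0 := by
    rw [hl, sq_sqrt (by positivity), div_mul_cancel₀ _ hdet.ne']
  have hm0 : m ≠ 0 := by positivity
  have hl0 : l ≠ 0 := by positivity
  set L := lowerTriangular l k m with hL
  have hD' : IsOpen (L ⁻¹' D) := hD.preimage L.continuous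
  have h0' : (0 : ℝ × ℝ) ∈ L ⁻¹' D := by simpa using h0
  have sa' := sa.comp_lowerTriangular (l := l) (k := k) (m := m)
  have sb' := sb.comp_lowerTriangular (l := l) (k := k) (m := m)
  have sc' := sc.comp_lowerTriangular (l := l) (k := k) (m := m)
  let Linv : ℝ × ℝ → ℝ × ℝ := fun x => (x.1 / l, (x.2 - k * (x.1 / l)) / m)
  have hleft (x : ℝ × ℝ) : Linv (L x) = x := by
    simp only [Linv, hL, lowerTriangular_apply]
    ext
    · simp only
      field_simp
    · simp only
      field_simp
      ring
  have hright (x : ℝ × ℝ) : L (Linv x) = x := by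
    simp only [Linv, hL, lowerTriangular_apply]
    ext
    · simp only
      field_simp
    · simp only
      field_simp
      ring
  let e : (ℝ × ℝ) ≃ₗ[ℝ] (ℝ × ℝ) := LinearEquiv.symm
    { (L : ℝ × ℝ →ₗ[ℝ] ℝ × ℝ) with
      invFun := Linv
      left_inv := hleft
      right_inv := hright }
  have he (x : ℝ × ℝ) : L (e x) = x := hright x
  have ht : Tendsto e (nhds 0) (nhds 0) := by
    have := e.toContinuousLinearEquiv.continuous.tendsto 0
    simpa using this
  have hnz' : ¬ (fun x => w (L x)) =ᶠ[nhds 0] 0 := fun h => hnz (by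
    filter_upwards [ht.eventually h] with x hx
    simpa only [he, Pi.zero_apply] using hx)
  obtain ⟨n, μ, hn, hμ, ho⟩ := exists_leading_term_of_divergence hD' h0' (w := fun x => w (L x))
    sw.comp_lowerTriangular
    (contDiffOn_const.mul sa')
    (contDiffOn_const.mul ((contDiffOn_const.mul sb').sub (contDiffOn_const.mul sa')))
    (((contDiffOn_const.mul sa').sub (contDiffOn_const.mul sb')).add (contDiffOn_const.mul sc'))
    (by simpa using hm2) (by
      simp only [map_zero, hk]
      field_simp
      ring) (by
      simp only [map_zero, hk]
      field_simp
      linear_combination hl2)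
    (divergence_comp_lowerTriangular hD sw sa sb sc hpde rfl rfl)
    (hflat.comp_lowerTriangular hD h0 sw) hnz'
  refine ⟨e, n, μ, hn, hμ, ?_⟩
  simpa only [Function.comp_def, he] using ho.comp_tendsto ht

end NormalForm

section MeanCurvature

variable {D : Set (ℝ × ℝ)} {u v w : ℝ × ℝ → ℝ} {H : ℝ}

/-- The difference of two solutions of the mean curvature equation solves a linear elliptic
equation in divergence form. -/
lemma exists_elliptic_equation_of_cmcDiv (hD : IsOpen D)
    (hu : ContDiffOn ℝ (⊤ : ℕ∞) u D) (hv : ContDiffOn ℝ (⊤ : ℕ∞) v D)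
    (hus : ∀ x ∈ D, gradSq u x < 1) (hvs : ∀ x ∈ D, gradSq v x < 1)
    (huc : ∀ x ∈ D, cmcDiv u x = 2 * H) (hvc : ∀ x ∈ D, cmcDiv v x = 2 * H) :
    ∃ a b c : ℝ × ℝ → ℝ, ContDiffOn ℝ (⊤ : ℕ∞) a D ∧ ContDiffOn ℝ (⊤ : ℕ∞) b D ∧
      ContDiffOn ℝ (⊤ : ℕ∞) c D ∧ (∀ x ∈ D, 0 < a x ∧ 0 < a x * c x - b x ^ 2) ∧
      ∀ x ∈ D, pd1 (fun x => a x * pd1 (fun x => u x - v x) x + b x * pd2 (fun x => u x - v x) x) x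
        + pd2 (fun x => b x * pd1 (fun x => u x - v x) x + c x * pd2 (fun x => u x - v x) x) x = 0 := by
  have su {f : ℝ × ℝ → ℝ} (sf : ContDiffOn ℝ (⊤ : ℕ∞) f D) (hfs : ∀ x ∈ D, gradSq f x < 1) :
      ContDiffOn ℝ (⊤ : ℕ∞) (fun x => (√(1 - gradSq f x))⁻¹) D := by
    have h : ContDiffOn ℝ (⊤ : ℕ∞) (fun x => 1 - gradSq f x) D :=
      contDiffOn_const.sub (((sf.pd1 hD).pow 2).add ((sf.pd2 hD).pow 2))
    exact (h.sqrt fun x hx => (sub_pos.2 (hfs x hx)).ne').inv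
      fun x hx => (sqrt_pos.2 (sub_pos.2 (hfs x hx))).ne'
  have pos {f : ℝ × ℝ → ℝ} (hfs : ∀ x ∈ D, gradSq f x < 1) {x : ℝ × ℝ} (hx : x ∈ D) :
      0 < (√(1 - gradSq f x))⁻¹ := inv_pos.2 (sqrt_pos.2 (sub_pos.2 (hfs x hx)))
  have sq {f : ℝ × ℝ → ℝ} (hfs : ∀ x ∈ D, gradSq f x < 1) {x : ℝ × ℝ} (hx : x ∈ D) :
      (√(1 - gradSq f x))⁻¹ ^ 2 * (1 - (pd1 f x ^ 2 + pd2 f x ^ 2)) = 1 := by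
    have h := sub_pos.2 (hfs x hx)
    rw [inv_pow, sq_sqrt h.le]
    exact inv_mul_cancel₀ h.ne'
  set P : ℝ × ℝ → ℝ := fun x => (√(1 - gradSq u x))⁻¹ with hP
  set Q : ℝ × ℝ → ℝ := fun x => (√(1 - gradSq v x))⁻¹ with hQ
  have sP : ContDiffOn ℝ (⊤ : ℕ∞) P D := su hu hus
  have sQ : ContDiffOn ℝ (⊤ : ℕ∞) Q D := su hv hvs
  have P0 {x : ℝ × ℝ} (hx : x ∈ D) : 0 < P x := pos hus hx
  have Q0 {x : ℝ × ℝ} (hx : x ∈ D) : 0 < Q x := pos hvs hx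
  set κ : ℝ × ℝ → ℝ := fun x => (P x * Q x) ^ 2 / (2 * (P x + Q x)) with hκ
  have sκ : ContDiffOn ℝ (⊤ : ℕ∞) κ D := ((sP.mul sQ).pow 2).div (contDiffOn_const.mul (sP.add sQ))
    fun x hx => by
      have := P0 hx
      have := Q0 hx
      positivity
  set s : ℝ × ℝ → ℝ := fun x => pd1 u x + pd1 v x with hs
  set t : ℝ × ℝ → ℝ := fun x => pd2 u x + pd2 v x with ht
  have ss : ContDiffOn ℝ (⊤ : ℕ∞) s D := (hu.pd1 hD).add (hv.pd1 hD)
  have st : ContDiffOn ℝ (⊤ : ℕ∞) t D := (hu.pd2 hD).add (hv.pd2 hD)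
  have sPQ : ContDiffOn ℝ (⊤ : ℕ∞) (fun x => (P x + Q x) / 2) D := (sP.add sQ).div_const 2
  refine ⟨fun x => (P x + Q x) / 2 + κ x * s x ^ 2, fun x => κ x * (s x * t x),
    fun x => (P x + Q x) / 2 + κ x * t x ^ 2, sPQ.add (sκ.mul (ss.pow 2)), sκ.mul (ss.mul st),
    sPQ.add (sκ.mul (st.pow 2)), fun x hx => ?_, fun x hx => ?_⟩
  · have hp := P0 hx
    have hq := Q0 hx
    have hk : 0 ≤ κ x := by positivity
    refine ⟨by positivity, ?_⟩
    have : 0 < ((P x + Q x) / 2) ^ 2 + (P x + Q x) / 2 * (κ x * (s x ^ 2 + t x ^ 2)) := by positivity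
    linarith
  · have key {y : ℝ × ℝ} (hy : y ∈ D) : P y - Q y
        = 2 * κ y * (s y * (pd1 u y - pd1 v y) + t y * (pd2 u y - pd2 v y)) := by
      have hp := P0 hy
      have hq := Q0 hy
      have h1 := sq hus hy
      have h2 := sq hvs hy
      change P y ^ 2 * _ = 1 at h1
      change Q y ^ 2 * _ = 1 at h2
      simp only [hκ, hs, ht]
      field_simp
      linear_combination Q y ^ 2 * h1 - P y ^ 2 * h2
    have dif {f : ℝ × ℝ → ℝ} (sf : ContDiffOn ℝ (⊤ : ℕ∞) f D) := sf.differentiableAt_of_isOpen hD hx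
    have h := (huc x hx).trans (hvc x hx).symm
    simp only [cmcDiv, div_eq_mul_inv] at h
    change pd1 (fun y => pd1 u y * P y) x + pd2 (fun y => pd2 u y * P y) x
      = pd1 (fun y => pd1 v y * Q y) x + pd2 (fun y => pd2 v y * Q y) x at h
    have h1 := pd1_sub (dif ((hu.pd1 hD).mul sP)) (dif ((hv.pd1 hD).mul sQ))
    have h2 := pd2_sub (dif ((hu.pd2 hD).mul sP)) (dif ((hv.pd2 hD).mul sQ))
    refine Eq.trans (congrArg₂ (· + ·) ((pd1_congr ?_).trans h1) ((pd2_congr ?_).trans h2))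
      (by linear_combination h) <;>
    · filter_upwards [hD.mem_nhds hx] with y hy
      have hu' := hu.differentiableAt_of_isOpen hD hy
      have hv' := hv.differentiableAt_of_isOpen hD hy
      rw [pd1_sub hu' hv', pd2_sub hu' hv']
      first
      | linear_combination -(s y / 2) * key hy
      | linear_combination -(t y / 2) * key hy

lemma flat_three_of_iteratedFDeriv (hD : IsOpen D) (h0 : (0 : ℝ × ℝ) ∈ D)
    (sw : ContDiffOn ℝ (⊤ : ℕ∞) w D) (h : ∀ k : ℕ, k ≤ 2 → iteratedFDeriv ℝ k w 0 = 0) :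
    Flat 3 w := by
  have hd : DifferentiableAt ℝ (fderiv ℝ w) 0 :=
    ((sw.fderiv_of_isOpen hD (m := (⊤ : ℕ∞)) (by simp)).contDiffAt
      (hD.mem_nhds h0)).differentiableAt (by simp)
  have hw0 : w 0 = 0 := by
    have := congrArg (fun T => T 0) (h 0 (by omega))
    simpa using this
  have hw1 (e : ℝ × ℝ) : fderiv ℝ w 0 e = 0 := by
    have := congrArg (fun T => T fun _ => e) (h 1 (by omega))
    simpa [iteratedFDeriv_one_apply] using this
  have hw2 (e e' : ℝ × ℝ) : fderiv ℝ (fun y => fderiv ℝ w y e) 0 e' = 0 := by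
    have := congrArg (fun T => T ![e', e]) (h 2 le_rfl)
    rw [fderiv_clm_apply hd (by fun_prop)]
    simpa [iteratedFDeriv_two_apply] using this
  exact ⟨hw0, ⟨hw1 _, ⟨hw2 _ _, trivial, trivial⟩, hw2 _ _, trivial, trivial⟩,
    hw1 _, ⟨hw2 _ _, trivial, trivial⟩, hw2 _ _, trivial, trivial⟩

end MeanCurvature

/-- Local behavior of the difference of two spacelike graphs of the same constant mean
curvature near a second-order contact point: after a linear change of coordinates,
`u - v = Re(λ(ξ + iη)ⁿ) + o((ξ² + η²)^{n/2})` with `n ≥ 3` and `λ ≠ 0`. -/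
theorem local_behavior_at_second_contact
    (D : Set (ℝ × ℝ)) (hD : IsOpen D) (h0 : (0 : ℝ × ℝ) ∈ D) (H : ℝ)
    (u v : ℝ × ℝ → ℝ)
    (hu : ContDiffOn ℝ (⊤ : ℕ∞) u D) (hv : ContDiffOn ℝ (⊤ : ℕ∞) v D)
    (hus : ∀ x ∈ D, gradSq u x < 1) (hvs : ∀ x ∈ D, gradSq v x < 1)
    (huc : ∀ x ∈ D, cmcDiv u x = 2 * H) (hvc : ∀ x ∈ D, cmcDiv v x = 2 * H)
    -- second-order contact at the origin
    (hcontact : ∀ k : ℕ, k ≤ 2 → iteratedFDeriv ℝ k (fun x => u x - v x) 0 = 0)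
    -- `u - v` is not identically zero near the origin
    (hnz : ¬ (fun x => u x - v x) =ᶠ[nhds (0 : ℝ × ℝ)] 0) :
    ∃ (L : (ℝ × ℝ) ≃ₗ[ℝ] (ℝ × ℝ)) (n : ℕ) (lam : ℂ), 3 ≤ n ∧ lam ≠ 0 ∧
      (fun x : ℝ × ℝ =>
          u x - v x - (lam * (((L x).1 : ℂ) + ((L x).2 : ℂ) * Complex.I) ^ n).re)
        =o[nhds (0 : ℝ × ℝ)] (fun x : ℝ × ℝ => ‖L x‖ ^ n) := by
  obtain ⟨a, b, c, sa, sb, sc, hpos, hpde⟩ := exists_elliptic_equation_of_cmcDiv hD hu hv hus hvs huc hvc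
  exact exists_leading_term_of_elliptic hD h0 (hu.sub hv) sa sb sc (hpos 0 h0).1 (hpos 0 h0).2 hpde
    (flat_three_of_iteratedFDeriv hD h0 (hu.sub hv) hcontact) hnz
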